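/- Let m, d ≥ 1 be integers and let ω ∈ ℝ^d satisfy ω·ν ≠ 0 for every nonzero ν ∈ ℤ^d. Let Γ be a symmetric positive definite real m×m matrix, let V : ℝ^m → ℝ be real analytic with g = ∇V, and let f : ℝ^d → ℝ^m be (2πℤ)^d-periodic and real analytic with mean f₀. Suppose c ∈ ℝ^m satisfies g(c) = f₀ and the Hessian matrix of V at c is negative definite. Then there exists ε₀ > 0 such that for every ε ∈ (0, ε₀) there is a real analytic, (2πℤ)^d-periodic function X_ε : ℝ^d → ℝ^m such that x(t) := c + X_ε(ωt) satisfies ε x''(t) + Γ x'(t) + ε g(x(t)) = ε f(ωt) for all t ∈ ℝ; moreover sup_{ψ∈ℝ^d} |X_ε(ψ)| → 0 as ε → 0⁺. -/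

import Mathlib

open scoped Real
open Filter

noncomputable section

/-- The mean of a `(2πℤ)^d`-periodic function over the fundamental box `[0,2π]^d`. -/
def boxMean (d m : ℕ) (F : (Fin d → ℝ) → (Fin m → ℝ)) : Fin m → ℝ :=
  ((2 * π)⁻¹ ^ d) • ∫ ψ in Set.univ.pi fun _ : Fin d => Set.Icc (0 : ℝ) (2 * π), F ψ

/-- `(2πℤ)^d`-periodicity. -/
def IsPeriodic2pi (d m : ℕ) (F : (Fin d → ℝ) → (Fin m → ℝ)) : Prop :=
  ∀ (ψ : Fin d → ℝ) (k : Fin d → ℤ), F (fun j => ψ j + 2 * π * k j) = F ψ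

/-- The Hessian matrix of `V : ℝ^m → ℝ` at the point `c`. -/
def hessianMatrix (m : ℕ) (V : (Fin m → ℝ) → ℝ) (c : Fin m → ℝ) :
    Matrix (Fin m) (Fin m) ℝ :=
  Matrix.of fun i j => iteratedFDeriv ℝ 2 V c ![Pi.single i 1, Pi.single j 1]

open scoped BoundedContinuousFunction Topology
set_option linter.unusedSectionVars false
set_option linter.unusedVariables false

section kernel
variable {Y F : Type*} [NormedAddCommGroup Y] [NormedSpace ℝ Y] [NormedAddCommGroup F]
  [NormedSpace ℝ F] 

/-- translation -/
def Tr (a : Y) (h : Y →ᵇ F) : Y →ᵇ F := h.compContinuous ⟨fun ψ => ψ + a, by fun_prop⟩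

@[simp] lemma Tr_apply (a : Y) (h : Y →ᵇ F) (ψ : Y) : Tr a h ψ = h (ψ + a) := rfl

lemma norm_Tr_le (a : Y) (h : Y →ᵇ F) : ‖Tr a h‖ ≤ ‖h‖ :=
  (BoundedContinuousFunction.norm_le (norm_nonneg _)).2 fun ψ => h.norm_coe_le_norm _

lemma kernel_bound {p : ℝ} (hp : 0 < p) (φ : ℝ → F) (C : ℝ)
    (hC : ∀ t, ‖φ t‖ ≤ C) : ‖∫ τ in Set.Ioi (0:ℝ), Real.exp (-p * τ) • φ τ‖ ≤ C / p := by
  have h1 : ∫ τ in Set.Ioi (0:ℝ), C * Real.exp (-p * τ) = C / p := by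
    rw [MeasureTheory.integral_const_mul, integral_exp_mul_Ioi (by linarith)]
    simp; field_simp
  rw [← h1]
  refine MeasureTheory.norm_integral_le_of_norm_le ?_ ?_
  · exact (integrableOn_exp_mul_Ioi (by linarith) 0).const_mul C
  · refine Eventually.of_forall fun τ => ?_
    rw [norm_smul, Real.norm_eq_abs, abs_of_pos (Real.exp_pos _), mul_comm]
    gcongr
    exact hC τ

lemma kernel_integrable {p : ℝ} (hp : 0 < p) (φ : ℝ → F) (hφ : Continuous φ) (C : ℝ)
    (hC : ∀ t, ‖φ t‖ ≤ C) (a : ℝ) :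
    MeasureTheory.IntegrableOn (fun τ => Real.exp (-p * τ) • φ τ) (Set.Ioi a) := by
  refine MeasureTheory.Integrable.mono'
    ((integrableOn_exp_mul_Ioi (by linarith : -p < 0) a).const_mul C) ?_ ?_
  · exact (Continuous.aestronglyMeasurable (by fun_prop))
  · refine Eventually.of_forall fun τ => ?_
    rw [norm_smul, Real.norm_eq_abs, abs_of_pos (Real.exp_pos _), mul_comm]
    gcongr
    exact hC τ

lemma kernel_deriv [CompleteSpace F] {p : ℝ} (hp : 0 < p) (φ : ℝ → F) (hφ : Continuous φ) (C : ℝ)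
    (hC : ∀ t, ‖φ t‖ ≤ C) (t : ℝ) :
    HasDerivAt (fun t => ∫ τ in Set.Ioi (0:ℝ), Real.exp (-p * τ) • φ (t + τ))
      (p • (∫ τ in Set.Ioi (0:ℝ), Real.exp (-p * τ) • φ (t + τ)) - φ t) t := by
  have key : ∀ t, ∫ τ in Set.Ioi (0:ℝ), Real.exp (-p * τ) • φ (t + τ)
      = Real.exp (p * t) • ((∫ s in Set.Ioi (0:ℝ), Real.exp (-p * s) • φ s)
        - ∫ s in (0:ℝ)..t, Real.exp (-p * s) • φ s) := by
    intro t
    have e1 : (∫ s in Set.Ioi (0:ℝ), Real.exp (-p * s) • φ s)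
        - ∫ s in (0:ℝ)..t, Real.exp (-p * s) • φ s
        = ∫ s in Set.Ioi t, Real.exp (-p * s) • φ s := by
      rw [sub_eq_iff_eq_add, add_comm]
      exact (intervalIntegral.integral_interval_add_Ioi (kernel_integrable hp φ hφ C hC _)
        (kernel_integrable hp φ hφ C hC _)).symm
    rw [e1]
    have e2 : ∫ s in Set.Ioi (0:ℝ), Real.exp (-p * (s + t)) • φ (s + t)
        = ∫ s in Set.Ioi t, Real.exp (-p * s) • φ s := by
      have := (MeasureTheory.measurePreserving_add_right MeasureTheory.volume t).setIntegral_preimage_emb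
        (MeasurableEquiv.addRight t).measurableEmbedding (fun s => Real.exp (-p * s) • φ s) (Set.Ioi t)
      simpa using this
    rw [← e2, ← MeasureTheory.integral_smul]
    congr 1
    ext τ
    rw [smul_smul, ← Real.exp_add, add_comm τ t]
    ring_nf
  have e3 : (fun t => ∫ τ in Set.Ioi (0:ℝ), Real.exp (-p * τ) • φ (t + τ)) = fun t =>
      Real.exp (p * t) • ((∫ s in Set.Ioi (0:ℝ), Real.exp (-p * s) • φ s)
        - ∫ s in (0:ℝ)..t, Real.exp (-p * s) • φ s) := funext key
  rw [key t, e3]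
  have d1 : HasDerivAt (fun t => Real.exp (p * t)) (Real.exp (p * t) * p) t := by
    simpa using ((hasDerivAt_id t).const_mul p).exp
  have d2 : HasDerivAt (fun t => ∫ s in (0:ℝ)..t, Real.exp (-p * s) • φ s)
      (Real.exp (-p * t) • φ t) t :=
    intervalIntegral.integral_hasDerivAt_right
      ((by fun_prop : Continuous fun s => Real.exp (-p * s) • φ s).intervalIntegrable _ _)
      ((by fun_prop : Continuous fun s => Real.exp (-p * s) • φ s).stronglyMeasurableAtFilter _ _)
      (by fun_prop : Continuous fun s => Real.exp (-p * s) • φ s).continuousAt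
  have d3 := d1.smul (d2.const_sub (∫ s in Set.Ioi (0:ℝ), Real.exp (-p * s) • φ s))
  refine HasDerivAt.congr_deriv d3 ?_
  rw [smul_neg, smul_smul, smul_smul, ← Real.exp_add]
  rw [show p * t + -p * t = 0 by ring, Real.exp_zero, one_smul, mul_comm p (Real.exp (p * t))]
  abel

/-- resolvent -/
def Sop (p : ℝ) (hp : 0 < p) (w : Y) : (Y →ᵇ F) →L[ℝ] (Y →ᵇ F) :=
  LinearMap.mkContinuous
    { toFun := fun h => BoundedContinuousFunction.ofNormedAddCommGroup
        (fun ψ => ∫ τ in Set.Ioi (0:ℝ), Real.exp (-p * τ) • h (ψ + τ • w))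
        (by
          refine MeasureTheory.continuous_of_dominated
            (bound := fun τ => ‖h‖ * Real.exp (-p * τ)) ?_ ?_ ?_ ?_
          · intro ψ
            exact (Continuous.aestronglyMeasurable (by fun_prop))
          · intro ψ
            refine Eventually.of_forall fun τ => ?_
            rw [norm_smul, Real.norm_eq_abs, abs_of_pos (Real.exp_pos _), mul_comm]
            gcongr
            exact h.norm_coe_le_norm _
          · exact ((integrableOn_exp_mul_Ioi (by linarith : -p < 0) 0).const_mul _)
          · refine Eventually.of_forall fun τ => by fun_prop)
        (‖h‖ / p) (fun ψ => kernel_bound hp _ _ fun t => h.norm_coe_le_norm _)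
      map_add' := fun h k => by
        ext1 ψ
        have hi : ∀ h : Y →ᵇ F, _ := fun h => kernel_integrable hp (fun τ => h (ψ + τ • w)) (by fun_prop) _
          (fun t => h.norm_coe_le_norm _) 0
        simp only [BoundedContinuousFunction.coe_ofNormedAddCommGroup,
          BoundedContinuousFunction.coe_add, Pi.add_apply, smul_add]
        exact MeasureTheory.integral_add (hi h) (hi k)
      map_smul' := fun a h => by
        ext1 ψ
        simp only [BoundedContinuousFunction.coe_ofNormedAddCommGroup,
          BoundedContinuousFunction.coe_smul, RingHom.id_apply, smul_comm _ a]
        exact MeasureTheory.integral_smul _ _ }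
    p⁻¹ (fun h => by
      refine (BoundedContinuousFunction.norm_le (by positivity)).2 fun ψ => ?_
      refine (kernel_bound hp _ ‖h‖ fun t => h.norm_coe_le_norm _).trans (le_of_eq ?_)
      rw [div_eq_inv_mul])

lemma Sop_apply (p : ℝ) (hp : 0 < p) (w : Y) (h : Y →ᵇ F) (ψ : Y) :
    Sop p hp w h ψ = ∫ τ in Set.Ioi (0:ℝ), Real.exp (-p * τ) • h (ψ + τ • w) := rfl

lemma norm_Sop_le (p : ℝ) (hp : 0 < p) (w : Y) : ‖(Sop p hp w : (Y →ᵇ F) →L[ℝ] (Y →ᵇ F))‖ ≤ p⁻¹ :=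
  LinearMap.mkContinuous_norm_le _ (by positivity) _

lemma Sop_Tr (p : ℝ) (hp : 0 < p) (w a : Y) (h : Y →ᵇ F) :
    Sop p hp w (Tr a h) = Tr a (Sop p hp w h) := by
  ext1 ψ
  simp only [Sop_apply, Tr_apply]
  congr 1; ext τ; congr 2; abel

lemma Sop_deriv [CompleteSpace F] (p : ℝ) (hp : 0 < p) (w : Y) (h : Y →ᵇ F) (ψ : Y) (t : ℝ) :
    HasDerivAt (fun t : ℝ => Sop p hp w h (ψ + t • w))
      (p • Sop p hp w h (ψ + t • w) - h (ψ + t • w)) t := by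
  have := kernel_deriv hp (fun t => h (ψ + t • w)) (by fun_prop) ‖h‖ (fun t => h.norm_coe_le_norm _) t
  simp only [add_smul, ← add_assoc] at this
  exact this

end kernel

/-- matrix resolvent -/
structure SpecRes {F : Type*} [NormedAddCommGroup F] [NormedSpace ℝ F] (M : F →L[ℝ] F) (n : ℕ) where
  proj : Fin n → (F →L[ℝ] F)
  ev : Fin n → ℝ
  pos : ∀ i, 0 < ev i
  sum_proj : ∑ i, proj i = ContinuousLinearMap.id ℝ F
  eig : ∀ i v, M (proj i v) = ev i • proj i v

section res
variable {Y F : Type*} [NormedAddCommGroup Y] [NormedSpace ℝ Y] [NormedAddCommGroup F]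
  [NormedSpace ℝ F] 

/-- pointwise action of a linear map -/
abbrev Pt (L : F →L[ℝ] F) : (Y →ᵇ F) →L[ℝ] (Y →ᵇ F) := L.compLeftContinuousBounded Y

lemma norm_Pt_le (L : F →L[ℝ] F) : ‖(Pt L : (Y →ᵇ F) →L[ℝ] (Y →ᵇ F))‖ ≤ ‖L‖ := by
  refine ContinuousLinearMap.opNorm_le_bound _ (norm_nonneg _) fun h => ?_
  refine (BoundedContinuousFunction.norm_le (by positivity)).2 fun ψ => ?_
  refine (L.le_opNorm _).trans ?_
  gcongr
  exact h.norm_coe_le_norm _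

def Rop {M : F →L[ℝ] F} {n : ℕ} (D : SpecRes M n) (w : Y) : (Y →ᵇ F) →L[ℝ] (Y →ᵇ F) :=
  ∑ i, (Pt (D.proj i)).comp (Sop (D.ev i) (D.pos i) w)

def SpecRes.bd {M : F →L[ℝ] F} {n : ℕ} (D : SpecRes M n) : ℝ := ∑ i, ‖D.proj i‖ * (D.ev i)⁻¹

lemma Rop_apply {M : F →L[ℝ] F} {n : ℕ} (D : SpecRes M n) (w : Y) (h : Y →ᵇ F) (ψ : Y) :
    Rop D w h ψ = ∑ i, D.proj i (Sop (D.ev i) (D.pos i) w h ψ) := by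
  simp [Rop, BoundedContinuousFunction.sum_apply]

lemma norm_Rop_le {M : F →L[ℝ] F} {n : ℕ} (D : SpecRes M n) (w : Y) :
    ‖(Rop D w : (Y →ᵇ F) →L[ℝ] (Y →ᵇ F))‖ ≤ D.bd := by
  refine (norm_sum_le _ _).trans (Finset.sum_le_sum fun i _ => ?_)
  refine (ContinuousLinearMap.opNorm_comp_le _ _).trans ?_
  gcongr
  · exact norm_Pt_le _
  · exact norm_Sop_le _ _ _

lemma Rop_Tr {M : F →L[ℝ] F} {n : ℕ} (D : SpecRes M n) (w a : Y) (h : Y →ᵇ F) :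
    Rop D w (Tr a h) = Tr a (Rop D w h) := by
  ext1 ψ
  simp only [Rop_apply, Tr_apply, Sop_Tr]

lemma Rop_deriv [CompleteSpace F] {M : F →L[ℝ] F} {n : ℕ} (D : SpecRes M n) (w : Y) (h : Y →ᵇ F) (ψ : Y) (t : ℝ) :
    HasDerivAt (fun t : ℝ => Rop D w h (ψ + t • w))
      (M (Rop D w h (ψ + t • w)) - h (ψ + t • w)) t := by
  have h1 : HasDerivAt (fun t : ℝ => Rop D w h (ψ + t • w))
    (∑ i, D.proj i (D.ev i • Sop (D.ev i) (D.pos i) w h (ψ + t • w) - h (ψ + t • w))) t := by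
    simp only [Rop_apply]
    exact HasDerivAt.fun_sum fun i _ =>
      (D.proj i).hasFDerivAt.comp_hasDerivAt t (Sop_deriv (D.ev i) (D.pos i) w h ψ t)
  convert h1 using 1
  simp only [map_sub, Finset.sum_sub_distrib, Rop_apply, map_sum, D.eig, map_smul]
  congr 1
  rw [← _root_.sum_apply, D.sum_proj]
  rfl

/-- derivative along a multiple of `w` -/
lemma Rop_deriv' [CompleteSpace F] {M : F →L[ℝ] F} {n : ℕ} (D : SpecRes M n) (w : Y) (σ : ℝ) (hσ : σ ≠ 0) (h : Y →ᵇ F) (ψ : Y) (t : ℝ) :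
    HasDerivAt (fun t : ℝ => Rop D (σ • w) h (ψ + t • w))
      (σ⁻¹ • (M (Rop D (σ • w) h (ψ + t • w)) - h (ψ + t • w))) t := by
  have h1 := Rop_deriv D (σ • w) h ψ (t * σ⁻¹)
  have h2 : HasDerivAt (fun t : ℝ => t * σ⁻¹) σ⁻¹ t := by
    simpa using (hasDerivAt_id t).mul_const σ⁻¹
  have h3 := h1.scomp t h2
  simpa [Function.comp_def, smul_smul, hσ] using h3

end res


section nem
variable {Y G F : Type*} [TopologicalSpace Y] [Nonempty Y] [NormedAddCommGroup G] [NormedSpace ℝ G]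
  [NormedAddCommGroup F] [NormedSpace ℝ F]

/-- pointwise lift of a family of multilinear maps -/
def liftML {n : ℕ} (P : Y → (G [×n]→L[ℝ] F)) (hP : Continuous P) (C : ℝ) (hC : ∀ y, ‖P y‖ ≤ C) :
    (Y →ᵇ G) [×n]→L[ℝ] (Y →ᵇ F) :=
  MultilinearMap.mkContinuous
    { toFun := fun v => BoundedContinuousFunction.ofNormedAddCommGroup
        (fun y => P y (fun i => v i y)) 
        (by
          refine Continuous.eval hP ?_
          exact continuous_pi fun i => (v i).continuous)
        (C * ∏ i, ‖v i‖) (fun y => by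
          refine ((P y).le_opNorm _).trans ?_
          refine mul_le_mul (hC y) ?_ (Finset.prod_nonneg fun _ _ => norm_nonneg _)
            ((norm_nonneg _).trans (hC y))
          exact Finset.prod_le_prod (fun _ _ => norm_nonneg _) fun i _ => (v i).norm_coe_le_norm _)
      map_update_add' := by
        intro _ v i a b
        ext1 y
        have := (P y).map_update_add (fun j => v j y) i (a y) (b y)
        simp only [BoundedContinuousFunction.coe_ofNormedAddCommGroup,
          BoundedContinuousFunction.coe_add, Pi.add_apply]
        convert this using 2 <;>
        · congr 1; ext j; by_cases h : j = i <;> [(subst h; simp); simp [h]]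
      map_update_smul' := by
        intro _ v i a b
        ext1 y
        have := (P y).map_update_smul (fun j => v j y) i a (b y)
        simp only [BoundedContinuousFunction.coe_ofNormedAddCommGroup,
          BoundedContinuousFunction.coe_smul]
        convert this using 2 <;>
        · congr 1; ext j; by_cases h : j = i <;> [(subst h; simp); simp [h]] }
    C (fun v => by
      · obtain ⟨y0⟩ := ‹Nonempty Y›
        refine (BoundedContinuousFunction.norm_le ?_).2 fun y => ?_
        · exact mul_nonneg ((norm_nonneg _).trans (hC y0)) (Finset.prod_nonneg fun _ _ => norm_nonneg _)
        · simp only [MultilinearMap.coe_mk, BoundedContinuousFunction.coe_ofNormedAddCommGroup]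
          refine ((P y).le_opNorm _).trans ?_
          refine mul_le_mul (hC y) ?_ (Finset.prod_nonneg fun _ _ => norm_nonneg _)
            ((norm_nonneg _).trans (hC y))
          exact Finset.prod_le_prod (fun _ _ => norm_nonneg _) fun i _ => (v i).norm_coe_le_norm _)

lemma liftML_apply {n : ℕ} (P : Y → (G [×n]→L[ℝ] F)) (hP : Continuous P) (C : ℝ) (hC : ∀ y, ‖P y‖ ≤ C)
    (v : Fin n → (Y →ᵇ G)) (y : Y) : liftML P hP C hC v y = P y (fun i => v i y) := rfl

lemma norm_liftML_le {n : ℕ} (P : Y → (G [×n]→L[ℝ] F)) (hP : Continuous P) (C : ℝ) (hC : ∀ y, ‖P y‖ ≤ C)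
    (h0 : 0 ≤ C) : ‖liftML P hP C hC‖ ≤ C := MultilinearMap.mkContinuous_norm_le _ h0 _

lemma nemytskii [CompleteSpace F] (P : ∀ n, Y → (G [×n]→L[ℝ] F)) (hP : ∀ n, Continuous (P n)) (C r : ℝ) (hr : 0 < r)
    (hC0 : 0 ≤ C)
    (hC : ∀ n y, ‖P n y‖ ≤ C * (r⁻¹) ^ n) (Fn : Y → G → F)
    (hsum : ∀ y v, ‖v‖ < r → HasSum (fun n => P n y (fun _ => v)) (Fn y v))
    (Φ : (Y →ᵇ G) → (Y →ᵇ F)) (hΦ : ∀ v, ‖v‖ < r → ∀ y, Φ v y = Fn y (v y)) :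
    HasFPowerSeriesOnBall Φ
      (fun n => liftML (P n) (hP n) (C * (r⁻¹) ^ n) (hC n)) 0 (ENNReal.ofReal r) := by
  have hb : ∀ n, ‖liftML (P n) (hP n) (C * (r⁻¹) ^ n) (hC n)‖ ≤ C * (r⁻¹) ^ n := fun n =>
    norm_liftML_le _ _ _ _ (by positivity)
  refine ⟨?_, by simpa using hr, ?_⟩
  · rw [ENNReal.ofReal]
    refine FormalMultilinearSeries.le_radius_of_bound _ C fun n => ?_
    rw [Real.coe_toNNReal _ hr.le]
    refine (mul_le_mul_of_nonneg_right (hb n) (by positivity)).trans (le_of_eq ?_)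
    rw [mul_assoc, ← mul_pow, inv_mul_cancel₀ hr.ne', one_pow, mul_one]
  · intro v hv
    have hv' : ‖v‖ < r := by
      rw [Metric.mem_eball, edist_zero_right, ← ofReal_norm] at hv
      exact (ENNReal.ofReal_lt_ofReal_iff hr).1 hv
    have hs : Summable fun n => liftML (P n) (hP n) (C * (r⁻¹) ^ n) (hC n) (fun _ => v) := by
      refine Summable.of_norm_bounded (g := fun n => C * (r⁻¹ * ‖v‖) ^ n) ?_ fun n => ?_
      · refine (summable_geometric_of_lt_one (by positivity) ?_).mul_left C
        rw [inv_mul_eq_div, div_lt_one hr]; exact hv'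
      · refine (ContinuousMultilinearMap.le_opNorm _ _).trans ?_
        simp only [Finset.prod_const, Finset.card_univ, Fintype.card_fin]
        refine (mul_le_mul_of_nonneg_right (hb n) (by positivity)).trans (le_of_eq ?_)
        rw [mul_pow, mul_assoc]
    have : (∑' n, liftML (P n) (hP n) (C * (r⁻¹) ^ n) (hC n) (fun _ => v)) = Φ (0 + v) := by
      ext1 y
      have h1 := (BoundedContinuousFunction.evalCLM ℝ y : (Y →ᵇ F) →L[ℝ] F).hasSum hs.hasSum
      have h2 := hsum y (v y) ((v.norm_coe_le_norm y).trans_lt hv')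
      rw [zero_add, hΦ v hv' y]
      exact h1.unique h2
    rw [← this]
    exact hs.hasSum
end nem

section taylor
variable {G F : Type*} [NormedAddCommGroup G] [NormedSpace ℝ G]
  [NormedAddCommGroup F] [NormedSpace ℝ F] [CompleteSpace F]

/-- Taylor coefficients -/
def tay (f : G → F) (n : ℕ) (x : G) : G [×n]→L[ℝ] F := ((n.factorial : ℝ)⁻¹) • iteratedFDeriv ℝ n f x

lemma tay_local (f : G → F) (hf : AnalyticOnNhd ℝ f Set.univ) (x : G) :
    ∃ r > 0, ∃ C : ℝ, ∀ y ∈ Metric.ball x r, (∀ n, ‖tay f n y‖ ≤ C * r⁻¹ ^ n) ∧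
      ∀ v, ‖v‖ < r → HasSum (fun n => tay f n y (fun _ => v)) (f (y + v)) := by
  obtain ⟨p, R, hp⟩ := hf x trivial
  obtain ⟨ρ, hρ0, hρ⟩ := ENNReal.lt_iff_exists_nnreal_btwn.1 hp.r_pos
  have hρ0 : 0 < ρ := by simpa using hρ0
  have h2 : ((ρ / 2 : NNReal) + (ρ / 2 : NNReal) : ENNReal) < p.radius := by
    rw [← ENNReal.coe_add, add_halves]; exact hρ.trans_le hp.r_le
  have hS := p.changeOriginSeries_summable_aux₁ h2
  set S := ∑' s : Σ k l : ℕ, { s : Finset (Fin (k + l)) // s.card = l }, 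
      ‖p (s.1 + s.2.1)‖₊ * (ρ / 2) ^ s.2.1 * (ρ / 2) ^ s.1 with hSdef
  refine ⟨(ρ / 2 : NNReal), by positivity, S, fun y hy => ?_⟩
  have hy' : ‖y - x‖₊ < ρ / 2 := by
    rw [← NNReal.coe_lt_coe]; simpa [dist_eq_norm] using hy
  have hyR : (‖y - x‖₊ : ENNReal) < R := 
    (ENNReal.coe_lt_coe.2 (hy'.trans_le (NNReal.half_le_self ρ))).trans hρ
  have hq := hp.changeOrigin hyR
  rw [add_sub_cancel] at hq
  have hfan : AnalyticOnNhd ℝ f (Metric.eball y (R - ‖y - x‖₊)) := fun z _ => hf z trivial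
  constructor
  · intro n
    have hqn : ‖p.changeOrigin (y - x) n‖₊ ≤ S * (ρ / 2)⁻¹ ^ n := by
      refine (p.nnnorm_changeOrigin_le n (hyR.trans_le hp.r_le)).trans ?_
      have e1 := (NNReal.summable_sigma.1 hS)
      have e2 : ∑' s : Σ l : ℕ, { s : Finset (Fin (n + l)) // s.card = l },
          ‖p (n + s.1)‖₊ * (ρ / 2) ^ s.1 * (ρ / 2) ^ n ≤ S := by
        rw [hSdef, hS.tsum_sigma' (fun k => e1.1 k)]
        exact e1.2.le_tsum n (fun _ _ => zero_le)
      rw [inv_pow, ← div_eq_mul_inv, le_div_iff₀ (by positivity), ← NNReal.tsum_mul_right]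
      refine le_trans ?_ e2
      refine Summable.tsum_le_tsum (fun s => ?_) ?_ (e1.1 n)
      · gcongr
      · refine NNReal.summable_of_le (fun s => ?_) (e1.1 n)
        gcongr
    have h3 : ‖iteratedFDeriv ℝ n f y‖ ≤ n.factorial * ‖p.changeOrigin (y - x) n‖ := by
      refine ContinuousMultilinearMap.opNorm_le_bound (by positivity) fun v => ?_
      rw [hq.iteratedFDeriv_eq_sum_of_completeSpace v]
      refine (norm_sum_le _ _).trans ?_
      have : ∀ σ : Equiv.Perm (Fin n), ‖p.changeOrigin (y - x) n (fun i => v (σ i))‖ ≤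
          ‖p.changeOrigin (y - x) n‖ * ∏ i, ‖v i‖ := fun σ => by
        refine (ContinuousMultilinearMap.le_opNorm _ _).trans (le_of_eq ?_)
        rw [Equiv.prod_comp σ (fun i => ‖v i‖)]
      refine (Finset.sum_le_sum fun σ _ => this σ).trans (le_of_eq ?_)
      simp [Fintype.card_perm, mul_assoc]
    rw [tay, norm_smul, norm_inv, Real.norm_natCast, inv_mul_le_iff₀ (by positivity)]
    refine h3.trans ?_
    gcongr
    have := NNReal.coe_le_coe.2 hqn
    push_cast at this ⊢
    exact this
  · intro v hv
    have hv' : v ∈ Metric.eball (0:G) (R - ‖y - x‖₊) := by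
      rw [Metric.mem_eball, edist_zero_right]
      have hv2 : ‖v‖₊ < ρ / 2 := by rw [← NNReal.coe_lt_coe]; simpa using hv
      rw [lt_tsub_iff_right]
      refine lt_of_le_of_lt (b := (ρ : ENNReal)) ?_ hρ
      rw [enorm_eq_nnnorm, ← ENNReal.coe_add, ENNReal.coe_le_coe, ← add_halves ρ]
      exact add_le_add hv2.le hy'.le
    convert hq.hasSum hv' using 1
    funext n
    rw [tay, _root_.smul_apply, hq.iteratedFDeriv_eq_sum_of_completeSpace]
    simp only [Finset.sum_const, Finset.card_univ, Fintype.card_perm, Fintype.card_fin]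
    rw [← Nat.cast_smul_eq_nsmul ℝ, smul_smul, inv_mul_cancel₀ (by positivity), one_smul]

lemma tay_continuous (f : G → F) (hf : AnalyticOnNhd ℝ f Set.univ) (n : ℕ) : Continuous (tay f n) :=
by
  have := ((hf.contDiff (n := n)).continuous_iteratedFDeriv le_rfl)
  unfold tay
  exact Continuous.fun_const_smul this _

lemma tay_uniform (f : G → F) (hf : AnalyticOnNhd ℝ f Set.univ) (K : Set G) (hK : IsCompact K) :
    ∃ r > 0, ∃ C : ℝ, 0 ≤ C ∧ ∀ y ∈ K, (∀ n, ‖tay f n y‖ ≤ C * r⁻¹ ^ n) ∧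
      ∀ v, ‖v‖ < r → HasSum (fun n => tay f n y (fun _ => v)) (f (y + v)) := by
  refine hK.induction_on (p := fun K => ∃ r > 0, ∃ C : ℝ, 0 ≤ C ∧ ∀ y ∈ K, (∀ n, ‖tay f n y‖ ≤ C * r⁻¹ ^ n) ∧
      ∀ v, ‖v‖ < r → HasSum (fun n => tay f n y (fun _ => v)) (f (y + v))) ?_ ?_ ?_ ?_
  · exact ⟨1, one_pos, 0, le_rfl, by simp⟩
  · rintro s t hst ⟨r, hr, C, hC, h⟩
    exact ⟨r, hr, C, hC, fun y hy => h y (hst hy)⟩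
  · rintro s t ⟨r, hr, C, hC, h⟩ ⟨r', hr', C', hC', h'⟩
    refine ⟨min r r', lt_min hr hr', max C C', le_max_of_le_left hC, ?_⟩
    rintro y (hy | hy)
    · refine ⟨fun n => ((h y hy).1 n).trans ?_, fun v hv => (h y hy).2 v (hv.trans_le (min_le_left _ _))⟩
      gcongr
      · exact le_max_left _ _
      · exact min_le_left _ _
    · refine ⟨fun n => ((h' y hy).1 n).trans ?_, fun v hv => (h' y hy).2 v (hv.trans_le (min_le_right _ _))⟩
      gcongr
      · exact le_max_right _ _
      · exact min_le_right _ _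
  · intro x hx
    obtain ⟨r, hr, C, h⟩ := tay_local f hf x
    refine ⟨Metric.ball x r, mem_nhdsWithin_of_mem_nhds (Metric.ball_mem_nhds x hr), r, hr, C, ?_, h⟩
    have := ((h x (Metric.mem_ball_self hr)).1 0)
    simp only [pow_zero, mul_one] at this
    exact (norm_nonneg _).trans this

/-- the superposition operator at a constant base point -/
lemma nem_const [ProperSpace G] {Y : Type*} [TopologicalSpace Y] [Nonempty Y] (g : G → F)
    (hg : AnalyticOnNhd ℝ g Set.univ) (c : G) :
    ∃ N : (Y →ᵇ G) → (Y →ᵇ F), (∀ v y, N v y = g (c + v y)) ∧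
      ∃ r > 0, ∀ v, ‖v‖ < r → AnalyticAt ℝ N v := by
  have hgc : Continuous g := continuousOn_univ.1 hg.continuousOn
  have hbd : ∀ v : Y →ᵇ G, ∃ C, ∀ y, ‖g (c + v y)‖ ≤ C := fun v => by
    obtain ⟨C, hC⟩ := (isCompact_closedBall c ‖v‖).exists_bound_of_continuousOn hgc.continuousOn
    exact ⟨C, fun y => hC _ (by simpa using v.norm_coe_le_norm y)⟩
  choose C hC using hbd
  let N : (Y →ᵇ G) → (Y →ᵇ F) := fun v => BoundedContinuousFunction.ofNormedAddCommGroup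
    (fun y => g (c + v y)) (by fun_prop) (C v) (hC v)
  refine ⟨N, fun v y => rfl, ?_⟩
  obtain ⟨r, hr, D, hD0, h⟩ := tay_uniform g hg {c} isCompact_singleton
  refine ⟨r, hr, ?_⟩
  have h := h c rfl
  have := nemytskii (fun n (_ : Y) => tay g n c) (fun n => continuous_const) D r hr hD0
    (fun n _ => h.1 n) (fun _ v => g (c + v)) (fun _ v hv => h.2 v hv) N (fun v _ y => rfl)
  intro v hv
  refine this.analyticAt_of_mem ?_
  rw [Metric.mem_eball, edist_zero_right, ← ofReal_norm]
  exact (ENNReal.ofReal_lt_ofReal_iff hr).2 hv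
end taylor

section trans
variable {F : Type*} [NormedAddCommGroup F] [NormedSpace ℝ F] [CompleteSpace F] {d : ℕ}

lemma exists_box (ψ : Fin d → ℝ) : ∃ k : Fin d → ℤ,
    (fun j => ψ j + 2 * π * k j) ∈ Set.Icc (0 : Fin d → ℝ) (fun _ => 2 * π) := by
  have hpi : (0:ℝ) < 2 * π := by positivity
  refine ⟨fun j => - ⌊ψ j / (2 * π)⌋, ?_, ?_⟩
  · intro j
    have := Int.floor_le (ψ j / (2 * π))
    rw [le_div_iff₀ hpi] at this
    simp only [Pi.zero_apply]; push_cast; nlinarith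
  · intro j
    have := (Int.lt_floor_add_one (ψ j / (2 * π))).le
    rw [div_le_iff₀ hpi] at this
    push_cast; nlinarith

lemma per_bound (f : (Fin d → ℝ) → F) (hc : Continuous f)
    (hper : ∀ (ψ : Fin d → ℝ) (k : Fin d → ℤ), f (fun j => ψ j + 2 * π * k j) = f ψ) :
    ∃ C, ∀ ψ, ‖f ψ‖ ≤ C := by
  obtain ⟨C, hC⟩ := (isCompact_Icc (a := (0 : Fin d → ℝ)) (b := fun _ => 2 * π)).exists_bound_of_continuousOn
    hc.continuousOn
  refine ⟨C, fun ψ => ?_⟩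
  obtain ⟨k, hk⟩ := exists_box ψ
  rw [← hper ψ k]; exact hC _ hk

lemma tr_analytic (f : (Fin d → ℝ) →ᵇ F) (hf : AnalyticOnNhd ℝ f Set.univ)
    (hper : ∀ (ψ : Fin d → ℝ) (k : Fin d → ℤ), f (fun j => ψ j + 2 * π * k j) = f ψ) :
    AnalyticAt ℝ (fun θ : Fin d → ℝ => Tr θ f) 0 := by
  obtain ⟨r, hr, C, hC0, h⟩ := tay_uniform f hf _ (isCompact_Icc (a := (0 : Fin d → ℝ)) (b := fun _ => 2 * π))
  have htp : ∀ n (ψ : Fin d → ℝ) (k : Fin d → ℤ), tay f n (fun j => ψ j + 2 * π * k j) = tay f n ψ := by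
    intro n ψ k
    have e : (fun ψ => f (ψ + fun j => 2 * π * k j)) = f := funext fun ψ => hper ψ k
    have := iteratedFDeriv_comp_add_right (𝕜 := ℝ) (f := f) n (fun j => 2 * π * k j) 
    rw [tay, tay]
    congr 1
    have h2 := congrFun (congrArg (iteratedFDeriv ℝ n) e) ψ
    rw [← h2, iteratedFDeriv_comp_add_right]
    rfl
  have h' : ∀ y, (∀ n, ‖tay f n y‖ ≤ C * r⁻¹ ^ n) ∧
      ∀ v, ‖v‖ < r → HasSum (fun n => tay f n y (fun _ => v)) (f (y + v)) := by
    intro y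
    obtain ⟨k, hk⟩ := exists_box y
    have := h _ hk
    simp only [htp] at this
    refine ⟨this.1, fun v hv => ?_⟩
    have h3 := this.2 v hv
    rw [← hper (y + v) k]
    convert h3 using 2
    ext j; simp; ring
  let Φ : ((Fin d → ℝ) →ᵇ (Fin d → ℝ)) → ((Fin d → ℝ) →ᵇ F) := fun v => 
    f.compContinuous ⟨fun y => y + v y, by fun_prop⟩
  have h1 := nemytskii (fun n => tay f n) (tay_continuous f hf) C r hr hC0 (fun n y => (h' y).1 n)
    (fun y v => f (y + v)) (fun y v hv => (h' y).2 v hv) Φ (fun v _ y => rfl)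
  let L : (Fin d → ℝ) →L[ℝ] ((Fin d → ℝ) →ᵇ (Fin d → ℝ)) := 
    LinearMap.mkContinuous { toFun := fun θ => BoundedContinuousFunction.const _ θ
                             map_add' := fun _ _ => rfl
                             map_smul' := fun _ _ => rfl } 1 (fun θ => by
      rw [one_mul]; exact BoundedContinuousFunction.norm_const_le θ)
  have h2 : AnalyticAt ℝ Φ (L 0) := by rw [map_zero]; exact h1.analyticAt
  exact h2.comp (L.analyticAt 0)
end trans

section solve
variable {E : Type*} [NormedAddCommGroup E] [NormedSpace ℝ E] [CompleteSpace E]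

lemma pert_approx {Ψ : E → E} {ρ : ℝ} (hL : LipschitzOnWith (1/2) Ψ (Metric.closedBall 0 ρ)) :
    ApproximatesLinearOn (fun z => z + Ψ z) (ContinuousLinearMap.id ℝ E) (Metric.closedBall 0 ρ) (1/2) := by
  intro z hz z' hz'
  have := hL.norm_sub_le hz hz'
  have e : (z + Ψ z) - (z' + Ψ z') - (ContinuousLinearMap.id ℝ E) (z - z') = Ψ z - Ψ z' := by
    rw [ContinuousLinearMap.id_apply]; abel
  rw [e]; exact this

lemma pert_solve {Ψ : E → E} {ρ : ℝ} (hL : LipschitzOnWith (1/2) Ψ (Metric.closedBall 0 ρ))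
    (h0 : Ψ 0 = 0) (y : E) (hy : 2 * ‖y‖ ≤ ρ) : ∃ z, ‖z‖ ≤ 2 * ‖y‖ ∧ z + Ψ z = y := by
  have h1 := (pert_approx hL).surjOn_closedBall_of_nonlinearRightInverse
    { toFun := id, nnnorm := 1, bound' := by simp, right_inv' := by simp } (ε := 2 * ‖y‖) (b := 0)
    (by positivity) (Metric.closedBall_subset_closedBall hy)
  obtain ⟨z, hz, hzy⟩ := h1 (a := y) (by simp [h0]; linarith)
  exact ⟨z, by simpa using hz, hzy⟩

lemma pert_inj {Ψ : E → E} {ρ : ℝ} (hL : LipschitzOnWith (1/2) Ψ (Metric.closedBall 0 ρ))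
    {z z' : E} (hz : ‖z‖ ≤ ρ) (hz' : ‖z'‖ ≤ ρ) : ‖z - z'‖ ≤ 2 * ‖(z + Ψ z) - (z' + Ψ z')‖ := by
  have := hL.norm_sub_le (x := z) (y := z') (by simpa using hz) (by simpa using hz')
  have h2 : ‖z - z'‖ ≤ ‖(z + Ψ z) - (z' + Ψ z')‖ + ‖Ψ z - Ψ z'‖ := by
    have := norm_sub_le ((z + Ψ z) - (z' + Ψ z')) (Ψ z - Ψ z')
    have e : (z + Ψ z) - (z' + Ψ z') - (Ψ z - Ψ z') = z - z' := by abel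
    rwa [e] at this
  push_cast at this
  linarith

lemma pert_analytic {A : Type*} [NormedAddCommGroup A] [NormedSpace ℝ A] {Ψ : E → E} {ρ : ℝ}
    (hL : LipschitzOnWith (1/2) Ψ (Metric.closedBall 0 ρ)) (ζ y : A → E) (a : A)
    (hz : ‖ζ a‖ < ρ) (hζ : ∀ θ, ‖ζ θ‖ ≤ ρ) (heq : ∀ θ, ζ θ + Ψ (ζ θ) = y θ)
    (hΨ : AnalyticAt ℝ Ψ (ζ a)) (hy : AnalyticAt ℝ y a) : AnalyticAt ℝ ζ a := by
  have hcont : ContinuousAt ζ a := by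
    rw [ContinuousAt, tendsto_iff_norm_sub_tendsto_zero]
    have h1 := (tendsto_iff_norm_sub_tendsto_zero.1 hy.continuousAt.tendsto).const_mul 2
    rw [mul_zero] at h1
    refine squeeze_zero (fun _ => norm_nonneg _) (fun θ => ?_) h1
    rw [← heq, ← heq]
    exact pert_inj hL (hζ _) (hζ _)
  have hd := hΨ.differentiableAt.hasFDerivAt
  have hn : ‖fderiv ℝ Ψ (ζ a)‖ ≤ (1/2 : NNReal) := 
    hd.le_of_lipschitzOn (s := Metric.closedBall 0 ρ)
      (mem_of_superset (Metric.isOpen_ball.mem_nhds (by simpa using hz)) Metric.ball_subset_closedBall) hL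
  let u : (E →L[ℝ] E)ˣ := Units.oneSub (-fderiv ℝ Ψ (ζ a)) (by
    rw [norm_neg]; refine hn.trans_lt ?_; push_cast; norm_num)
  let e : E ≃L[ℝ] E := ContinuousLinearEquiv.unitsEquiv ℝ E u
  have hG : AnalyticAt ℝ (fun z => z + Ψ z) (ζ a) := analyticAt_id.add hΨ
  have he : HasFDerivAt (fun z => z + Ψ z) (e : E →L[ℝ] E) (ζ a) := by
    have e1 : (e : E →L[ℝ] E) = ContinuousLinearMap.id ℝ E + fderiv ℝ Ψ (ζ a) := by
      have : (e : E →L[ℝ] E) = (u : E →L[ℝ] E) := rfl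
      rw [this, Units.val_oneSub, sub_neg_eq_add]; rfl
    rw [e1]
    exact (hasFDerivAt_id (ζ a)).add hd
  have hcd : ContDiffAt ℝ ⊤ (fun z => z + Ψ z) (ζ a) := hG.contDiffAt
  have hs := hcd.hasStrictFDerivAt' he (by simp)
  have hinv := hcd.to_localInverse he (by simp)
  have hinv' : AnalyticAt ℝ (hcd.localInverse he (by simp)) (ζ a + Ψ (ζ a)) :=
    hinv.analyticAt
  have hev := hcont.eventually (hs.eventually_left_inverse)
  rw [heq] at hinv'
  refine (hinv'.comp hy).congr ?_
  filter_upwards [hev] with θ hθ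
  simp only [heq] at hθ
  exact hθ
end solve

section avg

lemma Sop_comp {Y F F' : Type*} [NormedAddCommGroup Y] [NormedSpace ℝ Y] [NormedAddCommGroup F]
    [NormedSpace ℝ F] [NormedAddCommGroup F'] [NormedSpace ℝ F'] [CompleteSpace F] [CompleteSpace F']
    (p : ℝ) (hp : 0 < p) (w : Y) (L : F →L[ℝ] F') (h : Y →ᵇ F) :
    Sop p hp w (L.compLeftContinuousBounded Y h) = L.compLeftContinuousBounded Y (Sop p hp w h) := by
  ext1 ψ
  simp only [Sop_apply, ContinuousLinearMap.compLeftContinuousBounded_apply]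
  rw [← L.integral_comp_comm (kernel_integrable hp (fun τ => h (ψ + τ • w)) (by fun_prop) ‖h‖
    (fun t => h.norm_coe_le_norm _) 0)]
  simp

variable {d : ℕ}

/-- the mean over the period box, general target -/
def gmean {F : Type*} [NormedAddCommGroup F] [NormedSpace ℝ F] (h : (Fin d → ℝ) → F) : F :=
  ((2 * π)⁻¹ ^ d) • ∫ ψ in Set.univ.pi fun _ : Fin d => Set.Icc (0 : ℝ) (2 * π), h ψ

lemma box_compact : IsCompact (Set.univ.pi fun _ : Fin d => Set.Icc (0 : ℝ) (2 * π)) :=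
  isCompact_univ_pi fun _ => isCompact_Icc

lemma box_vol : (MeasureTheory.volume (Set.univ.pi fun _ : Fin d => Set.Icc (0 : ℝ) (2 * π)))
    = ENNReal.ofReal ((2 * π) ^ d) := by
  rw [MeasureTheory.volume_pi_pi]
  simp [Real.volume_Icc, ENNReal.ofReal_pow Real.two_pi_pos.le]

section g
variable {F : Type*} [NormedAddCommGroup F] [NormedSpace ℝ F] 

lemma box_int (h : (Fin d → ℝ) →ᵇ F) : MeasureTheory.IntegrableOn h
    (Set.univ.pi fun _ : Fin d => Set.Icc (0 : ℝ) (2 * π)) :=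
  h.continuous.continuousOn.integrableOn_compact box_compact

lemma gmean_norm_le (h : (Fin d → ℝ) →ᵇ F) : ‖gmean h‖ ≤ ‖h‖ := by
  have h1 := MeasureTheory.norm_setIntegral_le_of_norm_le_const (μ := MeasureTheory.volume)
    (s := Set.univ.pi fun _ : Fin d => Set.Icc (0 : ℝ) (2 * π)) (f := h) (C := ‖h‖)
    (by rw [box_vol]; exact ENNReal.ofReal_lt_top) (fun x _ => h.norm_coe_le_norm x)
  rw [MeasureTheory.measureReal_def, box_vol, ENNReal.toReal_ofReal (by positivity)] at h1
  rw [gmean, norm_smul, Real.norm_of_nonneg (by positivity), inv_pow, inv_mul_le_iff₀ (by positivity)]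
  linarith

lemma gmean_add (h k : (Fin d → ℝ) →ᵇ F) : gmean (h + k) = gmean h + gmean k := by
  rw [gmean, gmean, gmean, ← smul_add, ← MeasureTheory.integral_add (box_int h) (box_int k)]
  rfl

lemma gmean_comp {F' : Type*} [NormedAddCommGroup F'] [NormedSpace ℝ F'] [CompleteSpace F] [CompleteSpace F']
    (L : F →L[ℝ] F') (h : (Fin d → ℝ) →ᵇ F) :
    gmean (fun ψ => L (h ψ)) = L (gmean h) := by
  rw [gmean, gmean, L.integral_comp_comm (box_int h), map_smul]

/-- averaged resolvent -/
def dev (p : ℝ) (hp : 0 < p) (w : Fin d → ℝ) (h : (Fin d → ℝ) →ᵇ F) : (Fin d → ℝ) →ᵇ F :=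
  Sop p hp w (h - BoundedContinuousFunction.const _ (gmean h))

lemma dev_add (p : ℝ) (hp : 0 < p) (w : Fin d → ℝ) (h k : (Fin d → ℝ) →ᵇ F) :
    dev p hp w (h + k) = dev p hp w h + dev p hp w k := by
  rw [dev, dev, dev, ← map_add, gmean_add]
  congr 1
  ext1 ψ
  simp
  abel

lemma dev_norm_le (p : ℝ) (hp : 0 < p) (w : Fin d → ℝ) (h : (Fin d → ℝ) →ᵇ F) :
    ‖dev p hp w h‖ ≤ p⁻¹ * (2 * ‖h‖) := by
  refine (ContinuousLinearMap.le_opNorm _ _).trans ?_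
  refine mul_le_mul (norm_Sop_le _ _ _) ?_ (norm_nonneg _) (by positivity)
  refine (norm_sub_le _ _).trans ?_
  have := gmean_norm_le h
  have h2 := BoundedContinuousFunction.norm_const_le (α := Fin d → ℝ) (gmean h)
  linarith

lemma dev_comp {F' : Type*} [NormedAddCommGroup F'] [NormedSpace ℝ F'] [CompleteSpace F] [CompleteSpace F']
    (p : ℝ) (hp : 0 < p) (w : Fin d → ℝ) (L : F →L[ℝ] F') (h : (Fin d → ℝ) →ᵇ F) :
    dev p hp w (L.compLeftContinuousBounded _ h) = L.compLeftContinuousBounded _ (dev p hp w h) := by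
  rw [dev, dev, ← Sop_comp]
  congr 1
  ext1 ψ
  have : gmean (L.compLeftContinuousBounded (Fin d → ℝ) h) = L (gmean h) := gmean_comp L h
  simp [this]
end g

/-- pull back from the torus -/
def pull (q : C(UnitAddTorus (Fin d), ℂ)) : (Fin d → ℝ) →ᵇ ℂ :=
  BoundedContinuousFunction.ofNormedAddCommGroup
    (fun ψ => q (fun j => ((ψ j / (2 * π) : ℝ) : UnitAddCircle)))
    (by
      refine q.continuous.comp (continuous_pi fun j => ?_)
      exact (AddCircle.continuous_mk' 1).comp (by fun_prop)) ‖q‖ (fun ψ => q.norm_coe_le_norm _)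

lemma pull_apply (q : C(UnitAddTorus (Fin d), ℂ)) (ψ : Fin d → ℝ) :
    pull q ψ = q (fun j => ((ψ j / (2 * π) : ℝ) : UnitAddCircle)) := rfl

lemma pull_norm_le (q : C(UnitAddTorus (Fin d), ℂ)) : ‖pull q‖ ≤ ‖q‖ :=
  (BoundedContinuousFunction.norm_le (norm_nonneg _)).2 fun ψ => q.norm_coe_le_norm _

lemma exists_pull (h : (Fin d → ℝ) →ᵇ ℂ)
    (hper : ∀ (ψ : Fin d → ℝ) (k : Fin d → ℤ), h (fun j => ψ j + 2 * π * k j) = h ψ) :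
    ∃ q, pull q = h := by
  have hq : IsOpenQuotientMap (Pi.map (fun (_ : Fin d) (x : ℝ) => (x : UnitAddCircle))) :=
    IsOpenQuotientMap.piMap fun _ => QuotientAddGroup.isOpenQuotientMap_mk
  let h' : C(Fin d → ℝ, ℂ) := ⟨fun x => h (fun j => 2 * π * x j), by fun_prop⟩
  let π' : C(Fin d → ℝ, UnitAddTorus (Fin d)) := ⟨_, hq.continuous⟩
  have hπ : Topology.IsQuotientMap π' := hq.isQuotientMap
  have hf : Function.FactorsThrough h' π' := by
    intro x y hxy
    have : ∀ j, ∃ n : ℤ, x j = y j + n := fun j => by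
      have := congrFun hxy j
      simp only [π', ContinuousMap.coe_mk, Pi.map_apply] at this
      obtain ⟨n, hn⟩ := QuotientAddGroup.eq_iff_sub_mem.1 this
      refine ⟨n, ?_⟩
      simp at hn
      linarith
    choose n hn using this
    simp only [h', ContinuousMap.coe_mk]
    rw [← hper (fun j => 2 * π * y j) n]
    congr 1; ext j; rw [hn j]; ring
  refine ⟨hπ.lift h' hf, ?_⟩
  ext1 ψ
  rw [pull_apply]
  have := congrArg (fun k => k (fun j => ψ j / (2 * π))) (hπ.lift_comp h' hf)
  simp only [ContinuousMap.comp_apply] at this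
  refine Eq.trans ?_ (this.trans ?_)
  · rfl
  · simp only [h', ContinuousMap.coe_mk]
    congr 1; ext j; field_simp

lemma pull_mFourier (n : Fin d → ℤ) (ψ : Fin d → ℝ) :
    pull (UnitAddTorus.mFourier n) ψ = ∏ j, Complex.exp (n j * Complex.I * ψ j) := by
  rw [pull_apply]
  simp only [UnitAddTorus.mFourier, ContinuousMap.coe_mk, fourier_coe_apply]
  refine Finset.prod_congr rfl fun j _ => ?_
  congr 1
  have : (π : ℂ) ≠ 0 := by exact_mod_cast Real.pi_ne_zero
  push_cast
  field_simp

lemma gmean_mFourier (n : Fin d → ℤ) (hn : n ≠ 0) : gmean (pull (UnitAddTorus.mFourier n)) = 0 := by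
  obtain ⟨j, hj⟩ := Function.ne_iff.1 hn
  rw [gmean]
  simp only [pull_mFourier]
  rw [MeasureTheory.volume_pi, MeasureTheory.Measure.restrict_pi_pi,
    MeasureTheory.integral_fintype_prod_eq_prod (fun j (x : ℝ) => Complex.exp (n j * Complex.I * x)),
    Finset.prod_eq_zero (Finset.mem_univ j), smul_zero]
  rw [MeasureTheory.integral_Icc_eq_integral_Ioc, ← intervalIntegral.integral_of_le (by positivity)]
  have hj' : (n j : ℂ) ≠ 0 := by exact_mod_cast hj
  rw [integral_exp_mul_complex (by simp [hj'])]
  have := Complex.exp_int_mul_two_pi_mul_I (n j)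
  push_cast
  rw [show (n j : ℂ) * Complex.I * (2 * π) = n j * (2 * π * Complex.I) by ring, this]
  simp

lemma good_mFourier (p : ℝ) (hp : 0 < p) (ω : Fin d → ℝ)
    (hω : ∀ ν : Fin d → ℤ, ν ≠ 0 → (∑ j, ω j * ν j) ≠ 0) (n : Fin d → ℤ) :
    Tendsto (fun σ : ℝ => ‖dev p hp (σ • ω) (pull (UnitAddTorus.mFourier n))‖) atTop (𝓝 0) := by
  by_cases hn : n = 0
  · subst hn
    have hm : gmean (pull (UnitAddTorus.mFourier (0 : Fin d → ℤ))) = 1 := by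
      rw [gmean]
      simp only [pull_mFourier]
      have hpi : (π : ℂ) ≠ 0 := by exact_mod_cast Real.pi_ne_zero
      simp only [Pi.zero_apply, Int.cast_zero, zero_mul, Complex.exp_zero, Finset.prod_const_one]
      rw [MeasureTheory.setIntegral_const, MeasureTheory.measureReal_def, box_vol,
        ENNReal.toReal_ofReal (by positivity), smul_smul, inv_pow,
        inv_mul_cancel₀ (by positivity), one_smul]
    have : ∀ σ : ℝ, dev p hp (σ • ω) (pull (UnitAddTorus.mFourier 0)) = 0 := fun σ => by
      rw [dev, hm]
      have h0 : pull (UnitAddTorus.mFourier (0 : Fin d → ℤ)) -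
          BoundedContinuousFunction.const (Fin d → ℝ) (1 : ℂ) = 0 := by
        ext1 ψ
        simp [pull_mFourier]
      rw [h0, map_zero]
    simp [this]
  · have hs := hω n hn
    set s := ∑ j, ω j * n j with hsdef
    have key : ∀ σ : ℝ, 0 < σ → ‖dev p hp (σ • ω) (pull (UnitAddTorus.mFourier n))‖ ≤ |s|⁻¹ * σ⁻¹ := by
      intro σ hσ
      refine (BoundedContinuousFunction.norm_le (by positivity)).2 fun ψ => ?_
      rw [dev, gmean_mFourier n hn, Sop_apply]
      have e1 : ∀ τ : ℝ, Real.exp (-p * τ) • ((pull (UnitAddTorus.mFourier n) -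
          BoundedContinuousFunction.const (Fin d → ℝ) (0 : ℂ) : (Fin d → ℝ) →ᵇ ℂ) (ψ + τ • σ • ω))
          = (∏ j, Complex.exp (n j * Complex.I * ψ j)) * Complex.exp ((-p + σ * s * Complex.I) * τ) := by
        intro τ
        simp only [BoundedContinuousFunction.coe_sub, Pi.sub_apply, BoundedContinuousFunction.const_apply,
          sub_zero, pull_mFourier]
        rw [← Complex.exp_sum, ← Complex.exp_sum, Complex.real_smul, Complex.ofReal_exp, ← Complex.exp_add,
          ← Complex.exp_add, hsdef]
        congr 1
        push_cast
        simp only [Pi.add_apply, Pi.smul_apply, smul_eq_mul, Finset.mul_sum, Finset.sum_mul, add_mul,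
          mul_add]
        push_cast
        simp only [mul_add, Finset.sum_add_distrib]
        rw [add_left_comm]
        congr 2
        refine Finset.sum_congr rfl fun j _ => ?_
        ring
      simp_rw [e1]
      rw [MeasureTheory.integral_const_mul, integral_exp_mul_complex_Ioi (by simpa using hp)]
      rw [norm_mul, norm_prod]
      have e2 : ∀ j, ‖Complex.exp (n j * Complex.I * ψ j)‖ = 1 := fun j => by
        rw [Complex.norm_exp]; simp
      simp only [e2, Finset.prod_const_one, one_mul, Complex.ofReal_zero, mul_zero, Complex.exp_zero,
        norm_div, norm_neg, norm_one]
      rw [one_div, ← mul_inv]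
      refine inv_anti₀ (by positivity) ?_
      have := Complex.abs_im_le_norm (-(p : ℂ) + σ * s * Complex.I)
      simp [abs_mul, abs_of_pos hσ] at this
      linarith
    refine squeeze_zero' (Eventually.of_forall fun _ => norm_nonneg _)
      ((eventually_gt_atTop 0).mono key) ?_
    simpa using tendsto_inv_atTop_zero.const_mul (|s|⁻¹)

lemma good_all (p : ℝ) (hp : 0 < p) (ω : Fin d → ℝ)
    (hω : ∀ ν : Fin d → ℤ, ν ≠ 0 → (∑ j, ω j * ν j) ≠ 0) (q : C(UnitAddTorus (Fin d), ℂ)) :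
    Tendsto (fun σ : ℝ => ‖dev p hp (σ • ω) (pull q)‖) atTop (𝓝 0) := by
  have hspan : ∀ q ∈ Submodule.span ℂ (Set.range (UnitAddTorus.mFourier (d := Fin d))), 
      Tendsto (fun σ : ℝ => ‖dev p hp (σ • ω) (pull q)‖) atTop (𝓝 0) := by
    intro q hq
    induction hq using Submodule.span_induction with
    | mem x hx => obtain ⟨n, rfl⟩ := hx; exact good_mFourier p hp ω hω n
    | zero =>
      have : pull (0 : C(UnitAddTorus (Fin d), ℂ)) = 0 := rfl
      refine squeeze_zero (fun _ => norm_nonneg _) (fun σ => dev_norm_le _ _ _ _) ?_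
      simp [this]
    | add x y _ _ hx hy =>
      have : pull (x + y) = pull x + pull y := rfl
      refine squeeze_zero (fun _ => norm_nonneg _) (fun σ => ?_) (by simpa using hx.add hy)
      rw [this, dev_add]; exact norm_add_le _ _
    | smul c x _ hx =>
      let L : ℂ →L[ℝ] ℂ := ContinuousLinearMap.mul ℝ ℂ c
      have : pull (c • x) = L.compLeftContinuousBounded _ (pull x) := rfl
      refine squeeze_zero (fun _ => norm_nonneg _) (fun σ => ?_) 
        (by simpa using hx.const_mul ‖L.compLeftContinuousBounded (Fin d → ℝ)‖)
      rw [this, dev_comp]; exact ContinuousLinearMap.le_opNorm _ _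
  rw [Metric.tendsto_nhds]
  intro δ hδ
  have hcl : q ∈ closure (Submodule.span ℂ (Set.range (UnitAddTorus.mFourier (d := Fin d))) : Set _) := by
    have := UnitAddTorus.span_mFourier_closure_eq_top (d := Fin d)
    rw [← Submodule.topologicalClosure_coe, this]; trivial
  obtain ⟨q', hq', hd⟩ := Metric.mem_closure_iff.1 hcl (p * δ / 4) (by positivity)
  filter_upwards [(Metric.tendsto_nhds.1 (hspan q' hq')) (δ / 2) (by positivity)] with σ hσ
  simp only [dist_zero_right, norm_norm] at hσ ⊢
  have e : pull q = pull (q - q') + pull q' := by ext1 ψ; simp [pull_apply]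
  rw [e, dev_add]
  have h1 := dev_norm_le p hp (σ • ω) (pull (q - q'))
  have h2 : ‖pull (q - q')‖ < p * δ / 4 := (pull_norm_le _).trans_lt (by rwa [← dist_eq_norm])
  have h3 : p⁻¹ * (2 * ‖pull (q - q')‖) < δ / 2 := by
    rw [inv_mul_lt_iff₀ hp]; linarith
  have h4 := norm_add_le (dev p hp (σ • ω) (pull (q - q'))) (dev p hp (σ • ω) (pull q'))
  linarith

lemma avg_vec {m : ℕ} (p : ℝ) (hp : 0 < p) (ω : Fin d → ℝ)
    (hω : ∀ ν : Fin d → ℤ, ν ≠ 0 → (∑ j, ω j * ν j) ≠ 0) (h : (Fin d → ℝ) →ᵇ (Fin m → ℝ))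
    (hper : ∀ (ψ : Fin d → ℝ) (k : Fin d → ℤ), h (fun j => ψ j + 2 * π * k j) = h ψ) :
    Tendsto (fun σ : ℝ => Sop p hp (σ • ω)
      (h - BoundedContinuousFunction.const _ (boxMean d m h))) atTop (𝓝 0) := by
  change Tendsto (fun σ : ℝ => dev p hp (σ • ω) h) atTop (𝓝 0)
  rw [tendsto_zero_iff_norm_tendsto_zero]
  let L : Fin m → (Fin m → ℝ) →L[ℝ] ℂ := fun i => Complex.ofRealCLM.comp (ContinuousLinearMap.proj i)
  have h1 : ∀ i, Tendsto (fun σ : ℝ => ‖dev p hp (σ • ω) ((L i).compLeftContinuousBounded _ h)‖) atTop (𝓝 0) := by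
    intro i
    obtain ⟨q, hq⟩ := exists_pull ((L i).compLeftContinuousBounded _ h) (fun ψ k => by
      simp [hper ψ k])
    rw [← hq]
    exact good_all p hp ω hω q
  refine squeeze_zero (fun _ => norm_nonneg _) (fun σ => ?_) 
    (by simpa using tendsto_finsetSum Finset.univ (fun i _ => h1 i))
  refine (BoundedContinuousFunction.norm_le (Finset.sum_nonneg fun _ _ => norm_nonneg _)).2 fun ψ => ?_
  refine (pi_norm_le_iff_of_nonneg (Finset.sum_nonneg fun _ _ => norm_nonneg _)).2 fun i => ?_
  refine le_trans ?_ (Finset.single_le_sum (f := fun i => ‖dev p hp (σ • ω) ((L i).compLeftContinuousBounded _ h)‖)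
    (fun _ _ => norm_nonneg _) (Finset.mem_univ i))
  rw [dev_comp]
  refine le_trans (le_of_eq ?_) (BoundedContinuousFunction.norm_coe_le_norm _ ψ)
  simp [L]
end avg

section spec
variable {m : ℕ}

/-- the continuous linear map of a matrix -/
def mclm (M : Matrix (Fin m) (Fin m) ℝ) : (Fin m → ℝ) →L[ℝ] (Fin m → ℝ) :=
  LinearMap.toContinuousLinearMap (Matrix.mulVecLin M)

@[simp] lemma mclm_apply (M : Matrix (Fin m) (Fin m) ℝ) (v : Fin m → ℝ) : mclm M v = M.mulVec v := rfl

lemma specRes_diag (W W' : Matrix (Fin m) (Fin m) ℝ) (p : Fin m → ℝ) (hp : ∀ i, 0 < p i)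
    (h1 : W * W' = 1) (h2 : W' * W = 1) : Nonempty (SpecRes (mclm (W * Matrix.diagonal p * W')) m) := by
  refine ⟨⟨fun i => mclm (W * Matrix.diagonal (Pi.single i 1) * W'), p, hp, ?_, ?_⟩⟩
  · have e : ∑ i, Matrix.diagonal (Pi.single i (1:ℝ)) = (1 : Matrix (Fin m) (Fin m) ℝ) := by
      ext a b
      rw [Matrix.sum_apply]
      by_cases hab : a = b
      · subst hab; simp [Matrix.diagonal_apply, Pi.single_apply]
      · simp [Matrix.diagonal_apply, hab]
    ext1 v
    rw [sum_apply]
    simp only [mclm_apply, ← Matrix.sum_mulVec]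
    rw [← Finset.sum_mul, ← Finset.mul_sum, e, mul_one, h1, Matrix.one_mulVec]
    rfl
  · intro i v
    simp only [mclm_apply, Matrix.mulVec_mulVec, ← Matrix.smul_mulVec]
    congr 1
    have : Matrix.diagonal p * Matrix.diagonal (Pi.single i (1:ℝ)) = p i • Matrix.diagonal (Pi.single i (1:ℝ)) := by
      rw [Matrix.diagonal_mul_diagonal, ← Matrix.diagonal_smul]
      congr 1; ext j
      by_cases hj : j = i
      · subst hj; simp
      · simp [hj]
    calc W * Matrix.diagonal p * W' * (W * Matrix.diagonal (Pi.single i 1) * W')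
        = W * Matrix.diagonal p * (W' * W) * Matrix.diagonal (Pi.single i 1) * W' := by
          simp only [Matrix.mul_assoc]
      _ = _ := by rw [h2, mul_one, Matrix.mul_assoc W, this]; simp

lemma posDef_diag (C : Matrix (Fin m) (Fin m) ℝ) (hC : C.PosDef) :
    ∃ (W W' : Matrix (Fin m) (Fin m) ℝ) (p : Fin m → ℝ), (∀ i, 0 < p i) ∧ W * W' = 1 ∧ W' * W = 1 ∧
      C = W * Matrix.diagonal p * W' ∧ W' = W.conjTranspose := by
  refine ⟨hC.1.eigenvectorUnitary, star (hC.1.eigenvectorUnitary : Matrix (Fin m) (Fin m) ℝ), 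
    hC.1.eigenvalues, fun i => hC.eigenvalues_pos i, by simp, by simp, ?_, rfl⟩
  have := hC.1.spectral_theorem
  simpa [Unitary.conjStarAlgAut_apply] using this

lemma specRes_posDef (C : Matrix (Fin m) (Fin m) ℝ) (hC : C.PosDef) : Nonempty (SpecRes (mclm C) m) := by
  obtain ⟨W, W', p, hp, h1, h2, h, -⟩ := posDef_diag C hC
  rw [h]; exact specRes_diag W W' p hp h1 h2

lemma specRes_prod (B Γ : Matrix (Fin m) (Fin m) ℝ) (hB : B.PosDef) (hΓ : Γ.PosDef) :
    ∃ P : Matrix (Fin m) (Fin m) ℝ, P * Γ = B ∧ Nonempty (SpecRes (mclm P) m) := by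
  obtain ⟨U, U', q, hq, hU1, hU2, hU, rfl⟩ := posDef_diag Γ hΓ
  set S : Matrix (Fin m) (Fin m) ℝ := Matrix.diagonal (fun i => √(q i)) * U.conjTranspose with hSd
  set T : Matrix (Fin m) (Fin m) ℝ := U * Matrix.diagonal (fun i => (√(q i))⁻¹) with hT
  have hq' : ∀ i, √(q i) ≠ 0 := fun i => (Real.sqrt_pos.2 (hq i)).ne'
  have hST : S * T = 1 := by
    rw [hSd, hT, Matrix.mul_assoc, ← Matrix.mul_assoc _ U, hU2, one_mul, Matrix.diagonal_mul_diagonal]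
    simp [hq']
  have hTS : T * S = 1 := by
    rw [hSd, hT, Matrix.mul_assoc, ← Matrix.mul_assoc _ _ U.conjTranspose, Matrix.diagonal_mul_diagonal]
    simpa [hq'] using hU1
  have hΓS : Γ = S.conjTranspose * S := by
    rw [hU, hSd, Matrix.conjTranspose_mul, Matrix.conjTranspose_conjTranspose, Matrix.diagonal_conjTranspose,
      Matrix.mul_assoc U, Matrix.mul_assoc U]
    rw [← Matrix.mul_assoc (Matrix.diagonal _) (Matrix.diagonal _), Matrix.diagonal_mul_diagonal]
    simp [Real.mul_self_sqrt (hq _).le]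
  have hST' : T.conjTranspose * S.conjTranspose = 1 := by rw [← Matrix.conjTranspose_mul, hST, Matrix.conjTranspose_one]
  have hTS' : S.conjTranspose * T.conjTranspose = 1 := by rw [← Matrix.conjTranspose_mul, hTS, Matrix.conjTranspose_one]
  have hC : (T.conjTranspose * B * T).PosDef := hB.conjTranspose_mul_mul_same 
    (Matrix.mulVec_injective_of_isUnit (IsUnit.of_mul_eq_one S hTS))
  obtain ⟨W, W', p, hp, h1, h2, h, -⟩ := posDef_diag _ hC
  refine ⟨B * T * T.conjTranspose, ?_, ?_⟩
  · rw [hΓS]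
    calc B * T * T.conjTranspose * (S.conjTranspose * S) = B * T * (T.conjTranspose * S.conjTranspose) * S := by
          simp only [Matrix.mul_assoc]
      _ = B * (T * S) := by rw [hST', mul_one, Matrix.mul_assoc]
      _ = B := by rw [hTS, mul_one]
  · have e : B * T * T.conjTranspose = (S.conjTranspose * W) * Matrix.diagonal p * (W' * T.conjTranspose) := by
      calc B * T * T.conjTranspose = (S.conjTranspose * T.conjTranspose) * B * T * T.conjTranspose := by
            rw [hTS', one_mul]
        _ = S.conjTranspose * (T.conjTranspose * B * T) * T.conjTranspose := by simp only [Matrix.mul_assoc]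
        _ = _ := by rw [h]; simp only [Matrix.mul_assoc]
    rw [e]
    refine specRes_diag _ _ p hp ?_ ?_
    · calc _ = S.conjTranspose * (W * W') * T.conjTranspose := by simp only [Matrix.mul_assoc]
        _ = 1 := by rw [h1, mul_one, hTS']
    · calc _ = W' * (T.conjTranspose * S.conjTranspose) * W := by simp only [Matrix.mul_assoc]
        _ = 1 := by rw [hST', mul_one, h2]
end spec

section hess

lemma grad_analytic {m : ℕ} (V : (Fin m → ℝ) → ℝ) (hV : AnalyticOnNhd ℝ V Set.univ)
    (g : (Fin m → ℝ) → (Fin m → ℝ))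
    (hg : ∀ x i, g x i = fderiv ℝ V x (Pi.single i 1)) : AnalyticOnNhd ℝ g Set.univ := by
  have e : g = fun x i => fderiv ℝ V x (Pi.single i 1) := by ext x i; exact hg x i
  rw [e]
  intro x _
  refine AnalyticAt.pi fun i => ?_
  exact ((ContinuousLinearMap.apply ℝ ℝ (Pi.single i (1:ℝ) : Fin m → ℝ)).analyticAt _).comp (hV.fderiv x trivial)

lemma grad_deriv {m : ℕ} (V : (Fin m → ℝ) → ℝ) (hV : AnalyticOnNhd ℝ V Set.univ)
    (g : (Fin m → ℝ) → (Fin m → ℝ))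
    (hg : ∀ x i, g x i = fderiv ℝ V x (Pi.single i 1)) (c : Fin m → ℝ) :
    HasFDerivAt g (mclm (hessianMatrix m V c)) c := by
  have e : g = fun x i => fderiv ℝ V x (Pi.single i 1) := by ext x i; exact hg x i
  rw [e, hasFDerivAt_pi']
  intro i
  have hd : HasFDerivAt (fderiv ℝ V) (fderiv ℝ (fderiv ℝ V) c) c :=
    (hV.fderiv c trivial).differentiableAt.hasFDerivAt
  have h1 := (ContinuousLinearMap.apply ℝ ℝ (Pi.single i (1:ℝ) : Fin m → ℝ)).hasFDerivAt.comp c hd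
  refine h1.congr_fderiv ?_
  have hs : IsSymmSndFDerivAt ℝ V c := 
    (hV c trivial).contDiffAt (n := ⊤) |>.isSymmSndFDerivAt (by simp)
  ext1 v
  simp only [ContinuousLinearMap.comp_apply, ContinuousLinearMap.apply_apply, ContinuousLinearMap.proj_apply,
    mclm_apply]
  rw [hs]
  conv_lhs => rw [pi_eq_sum_univ' v]
  simp only [map_sum, map_smul, smul_eq_mul, Matrix.mulVec, dotProduct, hessianMatrix, Matrix.of_apply]
  refine Finset.sum_congr rfl fun j _ => ?_
  rw [iteratedFDeriv_two_apply, mul_comm]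
  simp only [Matrix.cons_val_zero, Matrix.cons_val_one]

lemma exists_Q {Y G : Type*} [NormedAddCommGroup G] [NormedSpace ℝ G] [CompleteSpace G] [ProperSpace G]
    [TopologicalSpace Y] [Nonempty Y] (g : G → G) (hg : AnalyticOnNhd ℝ g Set.univ) (c : G)
    (A : G →L[ℝ] G) (hA : HasFDerivAt g A c) :
    ∃ Q : (Y →ᵇ G) → (Y →ᵇ G), (∀ v y, Q v y = g (c + v y) - g c - A (v y)) ∧
      (∃ r > 0, ∀ v, ‖v‖ < r → AnalyticAt ℝ Q v) ∧
      ∀ κ : NNReal, 0 < κ → ∃ ρ > 0, LipschitzOnWith κ Q (Metric.closedBall 0 ρ) := by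
  obtain ⟨N, hN, r, hr, hNa⟩ := nem_const (Y := Y) g hg c
  let Q : (Y →ᵇ G) → (Y →ᵇ G) := fun v => N v - BoundedContinuousFunction.const Y (g c)
    - A.compLeftContinuousBounded Y v
  have hQ : ∀ v y, Q v y = g (c + v y) - g c - A (v y) := fun v y => by simp [Q, hN]
  have hQa : ∀ v, ‖v‖ < r → AnalyticAt ℝ Q v := fun v hv =>
    ((hNa v hv).sub analyticAt_const).sub ((A.compLeftContinuousBounded Y).analyticAt v)
  refine ⟨Q, hQ, ⟨r, hr, hQa⟩, ?_⟩
  have h0 : AnalyticAt ℝ Q 0 := hQa 0 (by simpa using hr)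
  have hz : fderiv ℝ Q 0 = 0 := by
    ext v y
    have h1 := (BoundedContinuousFunction.evalCLM ℝ y).hasFDerivAt.comp (0 : Y →ᵇ G) h0.differentiableAt.hasFDerivAt
    have e0 : (fun v : Y →ᵇ G => c + v y) 0 = c := by simp
    have h3 : HasFDerivAt (fun v : Y →ᵇ G => c + v y) (BoundedContinuousFunction.evalCLM ℝ y : (Y →ᵇ G) →L[ℝ] G) 0 :=
      (BoundedContinuousFunction.evalCLM ℝ y : (Y →ᵇ G) →L[ℝ] G).hasFDerivAt.const_add c
    have h2 : HasFDerivAt (fun v : Y →ᵇ G => g (c + v y) - g c - A (v y))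
        (A.comp (BoundedContinuousFunction.evalCLM ℝ y) - A.comp (BoundedContinuousFunction.evalCLM ℝ y)) 0 := by
      refine (HasFDerivAt.sub_const _ ?_).sub ?_
      · exact HasFDerivAt.comp (0 : Y →ᵇ G) (by simpa using hA) h3
      · exact (A.comp (BoundedContinuousFunction.evalCLM ℝ y)).hasFDerivAt
    have h4 : (fun v : Y →ᵇ G => g (c + v y) - g c - A (v y)) = (BoundedContinuousFunction.evalCLM ℝ y) ∘ Q := by
      ext1 v; exact (hQ v y).symm
    rw [h4] at h2
    have := congrArg (fun L => L v) (h1.unique h2)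
    simpa using this
  intro κ hκ
  have hs : HasStrictFDerivAt Q (0 : (Y →ᵇ G) →L[ℝ] (Y →ᵇ G)) 0 := hz ▸ h0.hasStrictFDerivAt
  obtain ⟨s, hs, hL⟩ := hs.exists_lipschitzOnWith_of_nnnorm_lt κ (by simpa using hκ)
  obtain ⟨ρ, hρ, hb⟩ := Metric.nhds_basis_closedBall.mem_iff.1 hs
  exact ⟨ρ, hρ, hL.mono hb⟩
end hess

section core

/-- the perturbation map -/
def Psi {E : Type*} [NormedAddCommGroup E] [NormedSpace ℝ E] (ε : ℝ) (K J S : E →L[ℝ] E) (Q : E → E) (z : E) : E :=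
  ε ^ 2 • S (K z) - J (Q (K z) + ε ^ 2 • S (S (K z)))

lemma Psi_lip {E : Type*} [NormedAddCommGroup E] [NormedSpace ℝ E] (ε : ℝ) (K J S : E →L[ℝ] E) (Q : E → E)
    (b j s ρ ρ0 : ℝ) (κ : NNReal) (hK : ‖K‖ ≤ b) (hJ : ‖J‖ ≤ j) (hS : ‖S‖ ≤ s)
    (hQ : LipschitzOnWith κ Q (Metric.closedBall 0 ρ0)) (hρ : b * ρ ≤ ρ0)
    (h1 : j * (κ * b) ≤ 1 / 4) (h2 : ε ^ 2 * (s * b + j * (s * (s * b))) ≤ 1 / 4) :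
    LipschitzOnWith (1/2) (Psi ε K J S Q) (Metric.closedBall 0 ρ) := by
  have hb : 0 ≤ b := (norm_nonneg _).trans hK
  have hj : 0 ≤ j := (norm_nonneg _).trans hJ
  have hs : 0 ≤ s := (norm_nonneg _).trans hS
  have hKle : ∀ x, ‖K x‖ ≤ b * ‖x‖ := fun x => K.le_of_opNorm_le hK x
  have hJle : ∀ x, ‖J x‖ ≤ j * ‖x‖ := fun x => J.le_of_opNorm_le hJ x
  have hSle : ∀ x, ‖S x‖ ≤ s * ‖x‖ := fun x => S.le_of_opNorm_le hS x
  have hmem : ∀ z ∈ Metric.closedBall (0 : E) ρ, K z ∈ Metric.closedBall (0 : E) ρ0 := fun z hz => by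
    rw [mem_closedBall_zero_iff] at hz ⊢
    exact (hKle z).trans ((mul_le_mul_of_nonneg_left hz hb).trans hρ)
  refine LipschitzOnWith.of_dist_le_mul fun z hz z' hz' => ?_
  rw [dist_eq_norm, dist_eq_norm]
  have hq := hQ.norm_sub_le (hmem z hz) (hmem z' hz')
  rw [← map_sub] at hq
  have e : Psi ε K J S Q z - Psi ε K J S Q z' = ε ^ 2 • S (K (z - z')) -
      J ((Q (K z) - Q (K z')) + ε ^ 2 • S (S (K (z - z')))) := by
    simp only [Psi, map_sub, map_add, map_smul, smul_sub]
    abel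
  rw [e]
  set n := ‖z - z'‖
  have k1 : ‖K (z - z')‖ ≤ b * n := hKle _
  have k2 : ‖S (K (z - z'))‖ ≤ s * (b * n) := (hSle _).trans (by gcongr)
  have k3 : ‖S (S (K (z - z')))‖ ≤ s * (s * (b * n)) := (hSle _).trans (by gcongr)
  have k4 : ‖Q (K z) - Q (K z')‖ ≤ κ * (b * n) := hq.trans (by gcongr)
  have k5 : ‖ε ^ 2 • S (K (z - z'))‖ ≤ ε ^ 2 * (s * (b * n)) := by
    rw [norm_smul, Real.norm_of_nonneg (sq_nonneg ε)]; gcongr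
  have k6 : ‖ε ^ 2 • S (S (K (z - z')))‖ ≤ ε ^ 2 * (s * (s * (b * n))) := by
    rw [norm_smul, Real.norm_of_nonneg (sq_nonneg ε)]; gcongr
  have k7 : ‖J ((Q (K z) - Q (K z')) + ε ^ 2 • S (S (K (z - z'))))‖ ≤
      j * (κ * (b * n) + ε ^ 2 * (s * (s * (b * n)))) :=
    (hJle _).trans (mul_le_mul_of_nonneg_left ((norm_add_le _ _).trans (add_le_add k4 k6)) hj)
  refine (norm_sub_le _ _).trans ((add_le_add k5 k7).trans ?_)
  have hn : 0 ≤ n := norm_nonneg _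
  push_cast
  nlinarith [mul_le_mul_of_nonneg_right h1 hn, mul_le_mul_of_nonneg_right h2 hn]

lemma Psi_analytic {E : Type*} [NormedAddCommGroup E] [NormedSpace ℝ E] (ε : ℝ) (K J S : E →L[ℝ] E) (Q : E → E)
    (z : E) (hQ : AnalyticAt ℝ Q (K z)) : AnalyticAt ℝ (Psi ε K J S Q) z := by
  have h1 : AnalyticAt ℝ (fun z => Q (K z)) z := hQ.comp (K.analyticAt z)
  have h2 : AnalyticAt ℝ (fun z => J (Q (K z) + ε ^ 2 • S (S (K z)))) z := by
    refine (J.analyticAt _).comp (h1.add ?_)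
    exact (ε ^ 2 • (S.comp (S.comp K))).analyticAt z
  exact ((ε ^ 2 • (S.comp K)).analyticAt z).sub h2

variable {d m : ℕ}

lemma avg_Rop (ω : Fin d → ℝ) (hω : ∀ ν : Fin d → ℤ, ν ≠ 0 → (∑ j, ω j * ν j) ≠ 0)
    {M : (Fin m → ℝ) →L[ℝ] (Fin m → ℝ)} {n : ℕ} (D : SpecRes M n) (h : (Fin d → ℝ) →ᵇ (Fin m → ℝ))
    (hper : ∀ (ψ : Fin d → ℝ) (k : Fin d → ℤ), h (fun j => ψ j + 2 * π * k j) = h ψ) :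
    Tendsto (fun ε : ℝ => Rop D (ε⁻¹ • ω) (h - BoundedContinuousFunction.const _ (boxMean d m h)))
      (𝓝[>] 0) (𝓝 0) := by
  have h1 : ∀ i, Tendsto (fun ε : ℝ => Pt (D.proj i) (Sop (D.ev i) (D.pos i) (ε⁻¹ • ω)
      (h - BoundedContinuousFunction.const _ (boxMean d m h)))) (𝓝[>] 0) (𝓝 0) := fun i => by
    have := (avg_vec (D.ev i) (D.pos i) ω hω h hper).comp tendsto_inv_nhdsGT_zero
    have h2 := ((Pt (D.proj i) : ((Fin d → ℝ) →ᵇ (Fin m → ℝ)) →L[ℝ] _).continuous.tendsto 0).comp this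
    rw [map_zero] at h2
    exact h2
  have h3 := tendsto_finsetSum Finset.univ (fun i _ => h1 i)
  rw [Finset.sum_const_zero] at h3
  refine h3.congr fun ε => ?_
  ext1 ψ
  rw [Rop_apply, BoundedContinuousFunction.sum_apply]
  rfl

lemma core_ode (ω : Fin d → ℝ) (Γ P H : Matrix (Fin m) (Fin m) ℝ) (hP : P * Γ = -H)
    {n n' : ℕ} (DG : SpecRes (mclm Γ) n) (DP : SpecRes (mclm P) n')
    (g : (Fin m → ℝ) → (Fin m → ℝ)) (c f0 : Fin m → ℝ) (hc : g c = f0)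
    (f : (Fin d → ℝ) →ᵇ (Fin m → ℝ))
    (Q : ((Fin d → ℝ) →ᵇ (Fin m → ℝ)) → ((Fin d → ℝ) →ᵇ (Fin m → ℝ)))
    (hQ : ∀ v y, Q v y = g (c + v y) - g c - mclm H (v y)) (ε : ℝ) (hε : 0 < ε)
    (z : (Fin d → ℝ) →ᵇ (Fin m → ℝ))
    (hz : z + Psi ε (Rop DG ((-ε) • ω)) (Rop DP (ε⁻¹ • ω)) (Pt (mclm P)) Q z =
      -Rop DP (ε⁻¹ • ω) (f - BoundedContinuousFunction.const _ f0)) (t : ℝ) :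
    ε • deriv (deriv fun s : ℝ => c + Rop DG ((-ε) • ω) z fun j => ω j * s) t
            + Γ.mulVec (deriv (fun s : ℝ => c + Rop DG ((-ε) • ω) z fun j => ω j * s) t)
            + ε • g (c + Rop DG ((-ε) • ω) z fun j => ω j * t)
          = ε • f fun j => ω j * t := by
  have hpath : ∀ s : ℝ, (fun j => ω j * s) = (0 : Fin d → ℝ) + s • ω := fun s => by
    ext j; simp [mul_comm]
  simp only [hpath]
  set X := Rop DG ((-ε) • ω) z with hX
  set p : ℝ → (Fin d → ℝ) := fun s => 0 + s • ω with hp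
  have hε' : ε ≠ 0 := hε.ne'
  have hX1 : ∀ s, HasDerivAt (fun s => X (p s)) (ε⁻¹ • (z (p s) - Γ.mulVec (X (p s)))) s := fun s => by
    have := Rop_deriv' DG ω (-ε) (by simpa using hε') z 0 s
    refine this.congr_deriv ?_
    rw [inv_neg, neg_smul, ← smul_neg, neg_sub]
    rfl
  set h := (f - BoundedContinuousFunction.const _ f0) - (Q X + ε ^ 2 • Pt (mclm P) (Pt (mclm P) X)) with hh
  set w := Rop DP (ε⁻¹ • ω) h with hw
  have hzw : z = -(ε ^ 2 • Pt (mclm P) X) - w := by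
    have e1 : w = Rop DP (ε⁻¹ • ω) (f - BoundedContinuousFunction.const _ f0) - 
      Rop DP (ε⁻¹ • ω) (Q X + ε ^ 2 • Pt (mclm P) (Pt (mclm P) X)) := by rw [hw, hh, map_sub]
    rw [Psi, ← hX] at hz
    rw [e1, ← sub_eq_zero]
    rw [← sub_eq_zero] at hz
    rw [← hz]
    abel
  have hzp : ∀ ψ, z ψ = -(ε ^ 2 • P.mulVec (X ψ)) - w ψ := fun ψ => by
    conv_lhs => rw [hzw]
    simp
  have hw1 : ∀ s, HasDerivAt (fun s => w (p s)) (ε • (P.mulVec (w (p s)) - h (p s))) s := fun s => by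
    have := Rop_deriv' DP ω ε⁻¹ (inv_ne_zero hε') h 0 s
    rw [inv_inv] at this
    exact this
  have hz1 : ∀ s, HasDerivAt (fun s => z (p s)) (ε • (f (p s) - g (c + X (p s)))) s := fun s => by
    have h1 := ((((mclm P).hasFDerivAt.comp_hasDerivAt s (hX1 s)).const_smul (ε ^ 2)).neg).sub (hw1 s)
    have h2 : HasDerivAt (fun s => z (p s)) _ s := h1.congr_of_eventuallyEq 
      (Eventually.of_forall fun s => hzp (p s))
    refine h2.congr_deriv ?_
    have ew : w (p s) = -(ε ^ 2 • P.mulVec (X (p s))) - z (p s) := by rw [hzp (p s)]; abel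
    have eh : h (p s) = f (p s) - f0 - (g (c + X (p s)) - f0 - H.mulVec (X (p s)) 
        + ε ^ 2 • P.mulVec (P.mulVec (X (p s)))) := by
      simp [hh, hQ, hc]
    have eP : P.mulVec (Γ.mulVec (X (p s))) = - H.mulVec (X (p s)) := by
      rw [Matrix.mulVec_mulVec, hP, Matrix.neg_mulVec]
    rw [ew, eh]
    simp only [mclm_apply, Matrix.mulVec_sub, Matrix.mulVec_smul, Matrix.mulVec_neg, eP, smul_smul]
    ext i
    simp only [Pi.add_apply, Pi.sub_apply, Pi.smul_apply, Pi.neg_apply, smul_eq_mul]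
    field_simp
    ring
  have d1 : (deriv fun s : ℝ => c + X (p s)) = fun s => ε⁻¹ • (z (p s) - Γ.mulVec (X (p s))) :=
    funext fun s => ((hX1 s).const_add c).deriv
  have d2 : deriv (fun s => ε⁻¹ • (z (p s) - Γ.mulVec (X (p s)))) t = 
      ε⁻¹ • (ε • (f (p t) - g (c + X (p t))) - Γ.mulVec (ε⁻¹ • (z (p t) - Γ.mulVec (X (p t))))) :=
    (((hz1 t).sub ((mclm Γ).hasFDerivAt.comp_hasDerivAt t (hX1 t))).const_smul ε⁻¹).deriv
  change ε • deriv (deriv fun s : ℝ => c + X (p s)) t + Γ.mulVec (deriv (fun s : ℝ => c + X (p s)) t)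
    + ε • g (c + X (p t)) = ε • f (p t)
  rw [d1, d2, smul_smul, mul_inv_cancel₀ hε', one_smul, smul_sub]
  abel
end core

section final
variable {d m : ℕ}

lemma core_Tr (ω : Fin d → ℝ) (Γ P H : Matrix (Fin m) (Fin m) ℝ)
    {n n' : ℕ} (DG : SpecRes (mclm Γ) n) (DP : SpecRes (mclm P) n')
    (g : (Fin m → ℝ) → (Fin m → ℝ)) (c : Fin m → ℝ)
    (Q : ((Fin d → ℝ) →ᵇ (Fin m → ℝ)) → ((Fin d → ℝ) →ᵇ (Fin m → ℝ)))
    (hQ : ∀ v y, Q v y = g (c + v y) - g c - mclm H (v y)) (ε : ℝ)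
    (z : (Fin d → ℝ) →ᵇ (Fin m → ℝ)) (a : Fin d → ℝ) :
    Psi ε (Rop DG ((-ε) • ω)) (Rop DP (ε⁻¹ • ω)) (Pt (mclm P)) Q (Tr a z) =
      Tr a (Psi ε (Rop DG ((-ε) • ω)) (Rop DP (ε⁻¹ • ω)) (Pt (mclm P)) Q z) := by
  have hQT : ∀ v, Q (Tr a v) = Tr a (Q v) := fun v => by
    ext1 ψ; rw [hQ, Tr_apply, Tr_apply, hQ]
  have hPT : ∀ v : (Fin d → ℝ) →ᵇ (Fin m → ℝ), Pt (mclm P) (Tr a v) = Tr a (Pt (mclm P) v) := fun v => rfl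
  have hadd : ∀ v v' : (Fin d → ℝ) →ᵇ (Fin m → ℝ), Tr a (v + v') = Tr a v + Tr a v' := fun v v' => rfl
  have hsub : ∀ v v' : (Fin d → ℝ) →ᵇ (Fin m → ℝ), Tr a (v - v') = Tr a v - Tr a v' := fun v v' => rfl
  have hsm : ∀ (s : ℝ) (v : (Fin d → ℝ) →ᵇ (Fin m → ℝ)), Tr a (s • v) = s • Tr a v := fun s v => rfl
  rw [Psi, Psi, Rop_Tr, hPT, hQT, hPT, hsub, hsm, ← Rop_Tr, hadd, hsm]

lemma core_all (ω : Fin d → ℝ) (hω : ∀ ν : Fin d → ℤ, ν ≠ 0 → (∑ j, ω j * ν j) ≠ 0)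
    (Γ H : Matrix (Fin m) (Fin m) ℝ) (hΓ : Γ.PosDef) (hH : (-H).PosDef)
    (g : (Fin m → ℝ) → (Fin m → ℝ)) (hga : AnalyticOnNhd ℝ g Set.univ)
    (c : Fin m → ℝ) (hgc : HasFDerivAt g (mclm H) c)
    (f : (Fin d → ℝ) →ᵇ (Fin m → ℝ))
    (hfper : ∀ (ψ : Fin d → ℝ) (k : Fin d → ℤ), f (fun j => ψ j + 2 * π * k j) = f ψ)
    (hfan : AnalyticOnNhd ℝ f Set.univ) (hc : g c = boxMean d m f) :
    ∃ ε₀ > (0 : ℝ), ∃ X : ℝ → ((Fin d → ℝ) →ᵇ (Fin m → ℝ)),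
      (∀ ε ∈ Set.Ioo (0 : ℝ) ε₀,
        AnalyticOnNhd ℝ (X ε) Set.univ ∧
        (∀ (ψ : Fin d → ℝ) (k : Fin d → ℤ), X ε (fun j => ψ j + 2 * π * k j) = X ε ψ) ∧
        ∀ t : ℝ,
          ε • deriv (deriv fun s : ℝ => c + X ε fun j => ω j * s) t
            + Γ.mulVec (deriv (fun s : ℝ => c + X ε fun j => ω j * s) t)
            + ε • g (c + X ε fun j => ω j * t)
          = ε • f fun j => ω j * t) ∧
      Tendsto (fun ε : ℝ => ‖X ε‖) (𝓝[>] 0) (𝓝 0) := by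
  obtain ⟨P, hP, ⟨DP⟩⟩ := specRes_prod (-H) Γ hH hΓ
  obtain ⟨DG⟩ := specRes_posDef Γ hΓ
  obtain ⟨Q, hQ, ⟨r, hr, hQa⟩, hQL⟩ := exists_Q (Y := Fin d → ℝ) g hga c (mclm H) hgc
  set b := DG.bd with hb
  set j := DP.bd with hj
  set s := ‖mclm P‖ with hs
  have hb0 : 0 ≤ b := Finset.sum_nonneg fun i _ => mul_nonneg (norm_nonneg _) (inv_nonneg.2 (DG.pos i).le)
  have hj0 : 0 ≤ j := Finset.sum_nonneg fun i _ => mul_nonneg (norm_nonneg _) (inv_nonneg.2 (DP.pos i).le)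
  have hs0 : 0 ≤ s := norm_nonneg _
  set κ : NNReal := ⟨1 / (4 * (j * b + 1)), by positivity⟩ with hκ
  have hκv : (κ : ℝ) = 1 / (4 * (j * b + 1)) := rfl
  have hκ0 : 0 < κ := by
    rw [← NNReal.coe_pos, hκv]; positivity
  have hκ1 : j * (κ * b) ≤ 1 / 4 := by
    rw [hκv, show j * (1 / (4 * (j * b + 1)) * b) = (j * b) / (4 * (j * b + 1)) by ring,
      div_le_div_iff₀ (by positivity) (by norm_num)]
    nlinarith
  obtain ⟨ρ0, hρ0, hLip⟩ := hQL κ hκ0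
  set ρ := min ρ0 (r / 2) / (b + 1) with hρ
  have hmin : 0 < min ρ0 (r / 2) := lt_min hρ0 (by positivity)
  have hρpos : 0 < ρ := by positivity
  have hbρ : b * ρ ≤ min ρ0 (r / 2) := by
    have : (b + 1) * ρ = min ρ0 (r / 2) := by rw [hρ]; field_simp
    nlinarith
  set F := f - BoundedContinuousFunction.const (Fin d → ℝ) (boxMean d m f) with hF
  set y : ℝ → ((Fin d → ℝ) →ᵇ (Fin m → ℝ)) := fun ε => -Rop DP (ε⁻¹ • ω) F with hy
  have hy0 : Tendsto (fun ε => ‖y ε‖) (𝓝[>] 0) (𝓝 0) := by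
    have h1 := (avg_Rop ω hω DP f hfper).norm
    rw [norm_zero] at h1
    refine h1.congr fun ε => ?_
    simp only [hy, norm_neg, hF]
  have hev : ∀ᶠ ε in 𝓝[>] (0:ℝ), ε ^ 2 * (s * b + j * (s * (s * b))) ≤ 1 / 4 ∧ 2 * ‖y ε‖ < ρ := by
    refine Filter.Eventually.and ?_ ?_
    · have : Tendsto (fun ε : ℝ => ε ^ 2 * (s * b + j * (s * (s * b)))) (𝓝 0) (𝓝 (0 ^ 2 * (s * b + j * (s * (s * b))))) :=
        (Continuous.tendsto (by fun_prop) 0)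
      have h2 := this.mono_left (nhdsWithin_le_nhds (s := Set.Ioi 0))
      exact h2.eventually (eventually_le_nhds (by norm_num))
    · have h2 := hy0.const_mul 2
      exact h2.eventually (eventually_lt_nhds (by simpa using hρpos))
  obtain ⟨ε₀, hε₀, hsub⟩ := mem_nhdsGT_iff_exists_Ioo_subset.1 hev
  set Ψ := fun ε => Psi ε (Rop DG ((-ε) • ω)) (Rop DP (ε⁻¹ • ω)) (Pt (mclm P)) Q with hΨ
  have hKn : ∀ ε : ℝ, ‖(Rop DG ((-ε) • ω) : ((Fin d → ℝ) →ᵇ (Fin m → ℝ)) →L[ℝ] _)‖ ≤ b := fun ε => norm_Rop_le _ _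
  have hL : ∀ ε ∈ Set.Ioo (0:ℝ) ε₀, LipschitzOnWith (1/2) (Ψ ε) (Metric.closedBall 0 ρ) := fun ε hε =>
    Psi_lip ε _ _ _ Q b j s ρ ρ0 κ (hKn ε) (norm_Rop_le _ _) (norm_Pt_le _) hLip
      (hbρ.trans (min_le_left _ _)) hκ1 (hsub hε).1
  have hQ0 : Q 0 = 0 := by ext1 ψ; rw [hQ]; simp
  have hΨ0 : ∀ ε, Ψ ε 0 = 0 := fun ε => by simp [hΨ, Psi, hQ0]
  have hsol : ∀ ε, ∃ z, ε ∈ Set.Ioo (0:ℝ) ε₀ → ‖z‖ ≤ 2 * ‖y ε‖ ∧ z + Ψ ε z = y ε := fun ε => by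
    by_cases hε : ε ∈ Set.Ioo (0:ℝ) ε₀
    · obtain ⟨z, hz⟩ := pert_solve (hL ε hε) (hΨ0 ε) (y ε) (hsub hε).2.le
      exact ⟨z, fun _ => hz⟩
    · exact ⟨0, fun h => absurd h hε⟩
  choose z hz using hsol
  refine ⟨ε₀, hε₀, fun ε => Rop DG ((-ε) • ω) (z ε), ?_, ?_⟩
  · intro ε hε
    obtain ⟨hz1, hz2⟩ := hz ε hε
    have hzρ : ‖z ε‖ < ρ := hz1.trans_lt (hsub hε).2
    have hTr : ∀ a, Tr a (z ε) + Ψ ε (Tr a (z ε)) = -Rop DP (ε⁻¹ • ω) (Tr a F) := fun a => by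
      rw [hΨ]
      simp only
      rw [core_Tr ω Γ P H DG DP g c Q hQ, Rop_Tr]
      have := congrArg (Tr a) hz2
      exact this
    have hFper : ∀ (ψ : Fin d → ℝ) (k : Fin d → ℤ), F (fun j => ψ j + 2 * π * k j) = F ψ := fun ψ k => by
      simp [hF, hfper]
    refine ⟨?_, ?_, ?_⟩
    · have hFan : AnalyticOnNhd ℝ F Set.univ := fun ψ _ => (hfan ψ trivial).sub analyticAt_const
      have hζ : AnalyticAt ℝ (fun θ : Fin d → ℝ => Tr θ (z ε)) 0 := by
        have hT0 : Tr (0 : Fin d → ℝ) (z ε) = z ε := by ext1 ψ; simp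
        refine pert_analytic (hL ε hε) (fun θ : Fin d → ℝ => Tr θ (z ε)) 
          (fun θ => -Rop DP (ε⁻¹ • ω) (Tr θ F)) 0 ?_ (fun θ => (norm_Tr_le _ _).trans hzρ.le) hTr ?_ ?_
        · rw [hT0]; exact hzρ
        · simp only [hT0]
          refine Psi_analytic ε _ _ _ Q _ (hQa _ ?_)
          refine (ContinuousLinearMap.le_of_opNorm_le _ (hKn ε) _).trans_lt ?_
          have h1 : b * ‖z ε‖ ≤ b * ρ := mul_le_mul_of_nonneg_left hzρ.le hb0
          have h2 := min_le_right ρ0 (r / 2)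
          linarith
        · exact (((Rop DP (ε⁻¹ • ω)).analyticAt _).comp (tr_analytic F hFan hFper)).neg
      intro ψ _
      have h1 : AnalyticAt ℝ (fun θ : Fin d → ℝ => BoundedContinuousFunction.evalCLM ℝ ψ 
          (Rop DG ((-ε) • ω) (Tr θ (z ε)))) (ψ - ψ) := by
        rw [sub_self]
        exact (((BoundedContinuousFunction.evalCLM ℝ ψ).comp (Rop DG ((-ε) • ω))).analyticAt _).comp hζ
      have h2 : AnalyticAt ℝ (fun φ : Fin d → ℝ => φ - ψ) ψ := analyticAt_id.sub analyticAt_const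
      have h3 := AnalyticAt.comp_of_eq (f := fun φ : Fin d → ℝ => φ - ψ) h1 h2 rfl
      refine h3.congr (Eventually.of_forall fun φ => ?_)
      simp [Rop_Tr]
    · intro ψ k
      set a : Fin d → ℝ := fun j => 2 * π * k j with ha
      have hTF : Tr a F = F := by
        ext1 ψ; rw [Tr_apply]; exact hFper ψ k
      have h1 := pert_inj (hL ε hε) (z := Tr a (z ε)) (z' := z ε) ((norm_Tr_le _ _).trans hzρ.le) hzρ.le
      rw [hTr, hTF, hz2] at h1
      have h2 : Tr a (z ε) = z ε := by
        rw [← sub_eq_zero, ← norm_le_zero_iff]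
        refine h1.trans (le_of_eq ?_)
        simp [hy]
      have h3 : Tr a (Rop DG ((-ε) • ω) (z ε)) = Rop DG ((-ε) • ω) (z ε) := by
        rw [← Rop_Tr, h2]
      exact congrArg (fun u => u ψ) h3
    · intro t
      exact core_ode ω Γ P H hP DG DP g c _ hc f Q hQ ε hε.1 (z ε) hz2 t
  · have h1 : Tendsto (fun ε => b * (2 * ‖y ε‖)) (𝓝[>] 0) (𝓝 0) := by
      simpa using (hy0.const_mul 2).const_mul b
    refine squeeze_zero' (Eventually.of_forall fun _ => norm_nonneg _) ?_ h1
    filter_upwards [Ioo_mem_nhdsGT hε₀] with ε hε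
    refine (ContinuousLinearMap.le_of_opNorm_le _ (hKn ε) _).trans ?_
    exact mul_le_mul_of_nonneg_left (hz ε hε).1 hb0
end final

theorem forced_quasiperiodic_response_solution_max
    (m d : ℕ) (hm : 1 ≤ m) (hd : 1 ≤ d)
    (ω : Fin d → ℝ) (hω : ∀ ν : Fin d → ℤ, ν ≠ 0 → (∑ j, ω j * ν j) ≠ 0)
    (Γ : Matrix (Fin m) (Fin m) ℝ) (hΓsymm : Γ.IsSymm) (hΓpos : Γ.PosDef)
    (V : (Fin m → ℝ) → ℝ) (hV : AnalyticOnNhd ℝ V Set.univ)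
    (g : (Fin m → ℝ) → (Fin m → ℝ))
    (hg : ∀ x i, g x i = fderiv ℝ V x (Pi.single i 1))
    (f : (Fin d → ℝ) → (Fin m → ℝ))
    (hfper : IsPeriodic2pi d m f) (hfan : AnalyticOnNhd ℝ f Set.univ)
    (c : Fin m → ℝ) (hc : g c = boxMean d m f)
    (hhess : (-(hessianMatrix m V c)).PosDef) :
    ∃ ε₀ > (0 : ℝ), ∃ X : ℝ → (Fin d → ℝ) → (Fin m → ℝ),
      (∀ ε ∈ Set.Ioo (0 : ℝ) ε₀,
        AnalyticOnNhd ℝ (X ε) Set.univ ∧ IsPeriodic2pi d m (X ε) ∧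
        ∀ t : ℝ,
          ε • deriv (deriv fun s : ℝ => c + X ε fun j => ω j * s) t
            + Γ.mulVec (deriv (fun s : ℝ => c + X ε fun j => ω j * s) t)
            + ε • g (c + X ε fun j => ω j * t)
          = ε • f fun j => ω j * t) ∧
      Tendsto (fun ε : ℝ => ⨆ ψ : Fin d → ℝ, ‖X ε ψ‖)
        (nhdsWithin 0 (Set.Ioi 0)) (nhds 0) := by
  have hfc : Continuous f := continuousOn_univ.1 hfan.continuousOn
  obtain ⟨C, hC⟩ := per_bound f hfc hfper
  obtain ⟨ε₀, hε₀, X, hX, hlim⟩ := core_all ω hω Γ (hessianMatrix m V c) hΓpos hhess g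
    (grad_analytic V hV g hg) c (grad_deriv V hV g hg c)
    (BoundedContinuousFunction.ofNormedAddCommGroup f hfc C hC) hfper hfan hc
  refine ⟨ε₀, hε₀, fun ε => X ε, hX, ?_⟩
  refine squeeze_zero (fun ε => Real.iSup_nonneg fun ψ => norm_nonneg _)
    (fun ε => Real.iSup_le (fun ψ => (X ε).norm_coe_le_norm ψ) (norm_nonneg _)) hlim

end
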